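/- arXiv:1906.07173 — 2 statements merged into one kernel-verified Lean document; each statement's English description precedes it below -/
import Mathlib

section
/- For every r>0 the following inequalities hold: K(r) ≤ (2/C₁)^{2/α}·((r²∨δ²)/δ²)·K^{(δ)}(r); h^{(δ)}(r) ≤ h(r) ≤ (2/C₁)^{4/α}·((r²∨δ²)/δ²)·K^{(δ)}(r); and h^{(δ)}(r) ≤ 4(2/C₁)^{4/α}·K^{(δ)}(r). -/
open MeasureTheory

/-- Comparison of `K`, `h` with their truncated versions `K^{(δ)}`, `h^{(δ)}`:
for every r > 0,
`K(r) ≤ (2/C₁)^{2/α} ((r²∨δ²)/δ²) K^{(δ)}(r)`,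
`h^{(δ)}(r) ≤ h(r) ≤ (2/C₁)^{4/α} ((r²∨δ²)/δ²) K^{(δ)}(r)`, and
`h^{(δ)}(r) ≤ 4 (2/C₁)^{4/α} K^{(δ)}(r)`. -/
theorem stmt_1 (ν μ : ℝ → ℝ) (h K hδ Kδ : ℝ → ℝ) (α C₁ δ0 δ : ℝ)
    (hα : 0 < α) (hα2 : α < 2) (hC₁ : 0 < C₁)
    (hδ0 : 0 < δ0) (hδ0' : δ0 ≤ 1 / 24) (hδpos : 0 < δ) (hδδ0 : δ ≤ δ0)
    -- ν is the density of a symmetric infinite Lévy measure on ℝ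
    (hνmeas : Measurable ν)
    (hνnonneg : ∀ x : ℝ, 0 ≤ ν x)
    (hνsymm : ∀ x : ℝ, ν (-x) = ν x)
    (hνint : Integrable (fun x : ℝ => min (x ^ 2) 1 * ν x))
    (hνinf : ¬ Integrable ν)
    -- μ = μ^{(δ)} is a symmetric truncation of ν
    (hμmeas : Measurable μ)
    (hμeq : ∀ x : ℝ, 0 < x → x ≤ δ → μ x = ν x)
    (hμbound : ∀ x : ℝ, 0 < x → 0 ≤ μ x ∧ μ x ≤ ν x)
    (hμzero : ∀ x : ℝ, 2 * δ ≤ x → μ x = 0)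
    (hμsymm : ∀ x : ℝ, μ (-x) = μ x)
    -- definitions of h, K, h^{(δ)}, K^{(δ)}
    (hdef : ∀ r : ℝ, 0 < r → h r = ∫ x : ℝ, min 1 (x ^ 2 / r ^ 2) * ν x)
    (Kdef : ∀ r : ℝ, 0 < r → K r = ∫ x in {x : ℝ | |x| ≤ r}, x ^ 2 / r ^ 2 * ν x)
    (hδdef : ∀ r : ℝ, 0 < r → hδ r = ∫ x : ℝ, min 1 (x ^ 2 / r ^ 2) * μ x)
    (Kδdef : ∀ r : ℝ, 0 < r → Kδ r = ∫ x in {x : ℝ | |x| ≤ r}, x ^ 2 / r ^ 2 * μ x)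
    -- consequence of the weak lower scaling condition
    (hhK : ∀ r : ℝ, 0 < r → h r ≤ (2 / C₁) ^ (2 / α) * K r) :
    ∀ r : ℝ, 0 < r →
      K r ≤ (2 / C₁) ^ (2 / α) * (max (r ^ 2) (δ ^ 2) / δ ^ 2) * Kδ r ∧
      hδ r ≤ h r ∧
      h r ≤ (2 / C₁) ^ (4 / α) * (max (r ^ 2) (δ ^ 2) / δ ^ 2) * Kδ r ∧
      hδ r ≤ 4 * (2 / C₁) ^ (4 / α) * Kδ r := by
  intro r hr
  -- pointwise facts on μ
  have hb : ∀ x : ℝ, x ≠ 0 → 0 ≤ μ x ∧ μ x ≤ ν x := by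
    intro x hx
    rcases lt_or_gt_of_ne hx with hx | hx
    · have := hμbound (-x) (by linarith)
      rwa [hμsymm, hνsymm] at this
    · exact hμbound x hx
  have he : ∀ x : ℝ, x ≠ 0 → |x| ≤ δ → μ x = ν x := by
    intro x hx hxd
    rcases lt_or_gt_of_ne hx with hx | hx
    · have := hμeq (-x) (by linarith) (by rwa [abs_of_neg hx] at hxd)
      rwa [hμsymm, hνsymm] at this
    · exact hμeq x hx (by rwa [abs_of_pos hx] at hxd)
  have hz : ∀ x : ℝ, 2 * δ ≤ |x| → μ x = 0 := by
    intro x hxd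
    rcases abs_cases x with ⟨h1, _⟩ | ⟨h1, _⟩
    · exact hμzero x (by rwa [h1] at hxd)
    · have := hμzero (-x) (by rwa [h1] at hxd)
      rwa [hμsymm] at this
  obtain ⟨F, hF⟩ : ∃ F : ℝ → ℝ → ℝ, F = fun s x => min 1 (x ^ 2 / s ^ 2) := ⟨_, rfl⟩
  obtain ⟨G, hG⟩ : ∃ G : ℝ → ℝ → ℝ,
    G = fun s => Set.indicator {x : ℝ | |x| ≤ s} (fun x => x ^ 2 / s ^ 2) := ⟨_, rfl⟩
  have hset : ∀ s : ℝ, MeasurableSet {x : ℝ | |x| ≤ s} := fun s =>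
    measurableSet_le measurable_id.abs measurable_const
  have hFm : ∀ s, Measurable (F s) := by
    intro s; rw [hF]; fun_prop
  have hGm : ∀ s, Measurable (G s) := by
    intro s; rw [hG]
    exact Measurable.indicator (by fun_prop) (hset s)
  have hF0 : ∀ s x, 0 ≤ F s x := by
    intro s x; rw [hF]; positivity
  have hG0 : ∀ s x, 0 ≤ G s x := by
    intro s x; rw [hG]; exact Set.indicator_nonneg (fun _ _ => by positivity) _
  have hGin : ∀ s x, |x| ≤ s → G s x = x ^ 2 / s ^ 2 := by
    intro s x hx; rw [hG]; exact Set.indicator_of_mem (by exact hx) _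
  have hGout : ∀ s x, ¬ |x| ≤ s → G s x = 0 := by
    intro s x hx; rw [hG]; exact Set.indicator_of_notMem (by exact hx) _
  have hFin : ∀ s x, |x| ≤ s → 0 < s → F s x = x ^ 2 / s ^ 2 := by
    intro s x hx hs
    rw [hF]
    apply min_eq_right
    rw [div_le_one (by positivity), ← sq_abs]
    exact pow_le_pow_left₀ (abs_nonneg x) hx 2
  have hGF : ∀ s, 0 < s → ∀ x, G s x ≤ F s x := by
    intro s hs x
    by_cases hx : |x| ≤ s
    · rw [hGin s x hx, hFin s x hx hs]
    · rw [hGout s x hx]; exact hF0 s x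
  have hFz : ∀ s, F s 0 = 0 := by intro s; rw [hF]; simp
  have hGz : ∀ s, 0 < s → G s 0 = 0 := by
    intro s hs; exact le_antisymm ((hGF s hs 0).trans (hFz s).le) (hG0 s 0)
  have hFν : ∀ s, 0 < s → Integrable (fun x => F s x * ν x) := by
    intro s hs
    refine (hνint.const_mul (max 1 (1 / s ^ 2))).mono' ((hFm s).mul hνmeas).aestronglyMeasurable ?_
    refine Filter.Eventually.of_forall fun x => ?_
    rw [Real.norm_of_nonneg (mul_nonneg (hF0 s x) (hνnonneg x)), ← mul_assoc]
    refine mul_le_mul_of_nonneg_right ?_ (hνnonneg x)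
    have h1 : (1:ℝ) ≤ max 1 (1 / s ^ 2) := le_max_left _ _
    have h2 : 1 / s ^ 2 ≤ max 1 (1 / s ^ 2) := le_max_right _ _
    rw [hF]
    rcases le_total (x ^ 2) 1 with hx | hx
    · rw [min_eq_left hx]
      refine (min_le_right _ _).trans ?_
      calc x ^ 2 / s ^ 2 = 1 / s ^ 2 * x ^ 2 := by ring
        _ ≤ _ := mul_le_mul_of_nonneg_right h2 (sq_nonneg x)
    · rw [min_eq_right hx, mul_one]
      exact (min_le_left _ _).trans h1
  have dom : ∀ s, 0 < s → ∀ g : ℝ → ℝ, Measurable g →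
      (∀ x, 0 ≤ g x ∧ g x ≤ F s x * ν x) → Integrable g := by
    intro s hs g hg hgb
    refine (hFν s hs).mono' hg.aestronglyMeasurable (Filter.Eventually.of_forall fun x => ?_)
    rw [Real.norm_of_nonneg (hgb x).1]
    exact (hgb x).2
  have hGν : ∀ s, 0 < s → Integrable (fun x => G s x * ν x) := fun s hs =>
    dom s hs _ ((hGm s).mul hνmeas) fun x => ⟨mul_nonneg (hG0 s x) (hνnonneg x),
      mul_le_mul_of_nonneg_right (hGF s hs x) (hνnonneg x)⟩
  have hFμle : ∀ s x, 0 ≤ F s x * μ x ∧ F s x * μ x ≤ F s x * ν x := by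
    intro s x
    by_cases hx : x = 0
    · subst hx; simp [hFz]
    · exact ⟨mul_nonneg (hF0 s x) (hb x hx).1, mul_le_mul_of_nonneg_left (hb x hx).2 (hF0 s x)⟩
  have hGμ0 : ∀ s, 0 < s → ∀ x, 0 ≤ G s x * μ x ∧ G s x * μ x ≤ F s x * ν x := by
    intro s hs x
    by_cases hx : x = 0
    · subst hx; simp [hFz, hGz s hs]
    · exact ⟨mul_nonneg (hG0 s x) (hb x hx).1,
        mul_le_mul (hGF s hs x) (hb x hx).2 (hb x hx).1 (hF0 s x)⟩
  have hFμ : ∀ s, 0 < s → Integrable (fun x => F s x * μ x) := fun s hs =>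
    dom s hs _ ((hFm s).mul hμmeas) (hFμle s)
  have hGμ : ∀ s, 0 < s → Integrable (fun x => G s x * μ x) := fun s hs =>
    dom s hs _ ((hGm s).mul hμmeas) (hGμ0 s hs)
  have hd : ∀ s, 0 < s → h s = ∫ x, F s x * ν x := by
    intro s hs; rw [hdef s hs, hF]
  have hδd : ∀ s, 0 < s → hδ s = ∫ x, F s x * μ x := by
    intro s hs; rw [hδdef s hs, hF]
  have key : ∀ s, ∀ f : ℝ → ℝ,
      ∫ x in {x : ℝ | |x| ≤ s}, x ^ 2 / s ^ 2 * f x = ∫ x, G s x * f x := by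
    intro s f
    rw [← integral_indicator (hset s)]
    congr 1
    funext x
    by_cases hx : |x| ≤ s
    · rw [hGin s x hx]; exact Set.indicator_of_mem (by exact hx) _
    · rw [hGout s x hx, zero_mul]; exact Set.indicator_of_notMem (by exact hx) _
  have Kd : ∀ s, 0 < s → K s = ∫ x, G s x * ν x := by
    intro s hs; rw [Kdef s hs, key]
  have Kδd : ∀ s, 0 < s → Kδ s = ∫ x, G s x * μ x := by
    intro s hs; rw [Kδdef s hs, key]
  -- comparison facts
  have KδK : ∀ s, 0 < s → s ≤ δ → Kδ s = K s := by
    intro s hs hsd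
    rw [Kd s hs, Kδd s hs]
    congr 1
    funext x
    by_cases hx : x = 0
    · subst hx; simp [hGz s hs]
    · by_cases hxs : |x| ≤ s
      · rw [he x hx (hxs.trans hsd)]
      · simp [hGout s x hxs]
  have Kh : ∀ s, 0 < s → K s ≤ h s := by
    intro s hs
    rw [Kd s hs, hd s hs]
    exact integral_mono (hGν s hs) (hFν s hs) fun x =>
      mul_le_mul_of_nonneg_right (hGF s hs x) (hνnonneg x)
  have Kδ0 : 0 ≤ Kδ r := by
    rw [Kδd r hr]; exact integral_nonneg fun x => (hGμ0 r hr x).1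
  have hpos : 0 < h r := by
    have h0 : 0 ≤ h r := by
      rw [hd r hr]; exact integral_nonneg fun x => mul_nonneg (hF0 r x) (hνnonneg x)
    refine lt_of_le_of_ne h0 fun hh => hνinf ?_
    rw [hd r hr, eq_comm, integral_eq_zero_iff_of_nonneg
      (fun x => mul_nonneg (hF0 r x) (hνnonneg x)) (hFν r hr)] at hh
    have hne : ∀ᵐ x : ℝ, x ≠ 0 := by
      simp [ae_iff, measure_singleton]
    refine (integrable_zero ℝ ℝ volume).congr ?_
    filter_upwards [hh, hne] with x hx hx0
    have : F r x ≠ 0 := by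
      rw [hF]; positivity
    simp only [Pi.zero_apply, mul_eq_zero, this, false_or] at hx
    simp [hx]
  have hc0 : 0 < (2 / C₁) ^ (2 / α) := Real.rpow_pos_of_pos (by positivity) _
  have hcc : (2 / C₁) ^ (4 / α) = (2 / C₁) ^ (2 / α) * (2 / C₁) ^ (2 / α) := by
    rw [← Real.rpow_add (by positivity)]; congr 1; ring
  rw [hcc]
  generalize (2 / C₁) ^ (2 / α) = c at *
  have hc1 : 1 ≤ c := by
    have h1 := hhK r hr
    have h2 := Kh r hr
    by_contra hlt
    push Not at hlt
    nlinarith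
  have P1 : K r ≤ c * (max (r ^ 2) (δ ^ 2) / δ ^ 2) * Kδ r := by
    rcases le_total r δ with hrd | hrd
    · rw [max_eq_right (pow_le_pow_left₀ hr.le hrd 2), div_self (by positivity), mul_one,
        ← KδK r hr hrd]
      nlinarith
    · rw [max_eq_left (pow_le_pow_left₀ hδpos.le hrd 2)]
      have h1 : h r ≤ h δ := by
        rw [hd r hr, hd δ hδpos]
        refine integral_mono (hFν r hr) (hFν δ hδpos) fun x => ?_
        refine mul_le_mul_of_nonneg_right ?_ (hνnonneg x)
        rw [hF]
        exact min_le_min le_rfl (div_le_div_of_nonneg_left (sq_nonneg x) (by positivity)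
          (pow_le_pow_left₀ hδpos.le hrd 2))
      have h2 : Kδ δ ≤ r ^ 2 / δ ^ 2 * Kδ r := by
        rw [Kδd r hr, Kδd δ hδpos, ← integral_const_mul]
        refine integral_mono (hGμ δ hδpos) ((hGμ r hr).const_mul _) fun x => ?_
        by_cases hx : |x| ≤ δ
        · simp only [hGin δ x hx, hGin r x (hx.trans hrd)]
          apply le_of_eq
          field_simp
        · simp only [hGout δ x hx, zero_mul]
          exact mul_nonneg (by positivity) (hGμ0 r hr x).1
      calc K r ≤ h r := Kh r hr
        _ ≤ h δ := h1
        _ ≤ c * K δ := hhK δ hδpos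
        _ = c * Kδ δ := by rw [KδK δ hδpos le_rfl]
        _ ≤ c * (r ^ 2 / δ ^ 2 * Kδ r) := mul_le_mul_of_nonneg_left h2 hc0.le
        _ = _ := by ring
  have P2 : hδ r ≤ h r := by
    rw [hd r hr, hδd r hr]
    exact integral_mono (hFμ r hr) (hFν r hr) fun x => (hFμle r x).2
  have P3 : h r ≤ c * c * (max (r ^ 2) (δ ^ 2) / δ ^ 2) * Kδ r := by
    calc h r ≤ c * K r := hhK r hr
      _ ≤ c * (c * (max (r ^ 2) (δ ^ 2) / δ ^ 2) * Kδ r) := mul_le_mul_of_nonneg_left P1 hc0.le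
      _ = _ := by ring
  refine ⟨P1, P2, P3, ?_⟩
  rcases le_total r (2 * δ) with hrd | hrd
  · have hm : max (r ^ 2) (δ ^ 2) / δ ^ 2 ≤ 4 := by
      rw [div_le_iff₀ (by positivity)]
      exact max_le (by nlinarith) (by nlinarith)
    calc hδ r ≤ h r := P2
      _ ≤ c * c * (max (r ^ 2) (δ ^ 2) / δ ^ 2) * Kδ r := P3
      _ ≤ c * c * 4 * Kδ r := by gcongr
      _ = _ := by ring
  · have heq : hδ r = Kδ r := by
      rw [hδd r hr, Kδd r hr]
      congr 1
      funext x
      by_cases hx : |x| ≤ r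
      · rw [hGin r x hx, hFin r x hx hr]
      · rw [hz x (hrd.trans (not_le.mp hx).le)]; simp
    rw [heq]
    have : 1 ≤ 4 * (c * c) := by nlinarith
    nlinarith
end

section
/- For any δ∈(0,δ₀] there exists a constant c=c(α,δ,h,C₁) such that for all t>0 and x∈ℝ: (i) g_t^{(δ)}(x) ≤ c·(t∧1)^{|x|/(8δ)}·e^{ct}·(h^{−1}(1/t))^{−1}·e^{−|x|}; (ii) |d/dx g_t^{(δ)}(x)| ≤ c·(t∧1)^{|x|/(8δ)}·e^{ct}·(h^{−1}(1/t))^{−3}·e^{−|x|}; (iii) |d²/dx² g_t^{(δ)}(x)| ≤ c·(t∧1)^{|x|/(8δ)}·e^{ct}·[(h^{−1}(1/t))^{−3}+(h^{−1}(1/t))^{−5}]·e^{−|x|}; (iv) |d/dx g_t^{(δ)}(x)| ≤ c·e^{ct}·|x|·(h^{−1}(1/t))^{−2}·g*_t(x). -/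
open Filter MeasureTheory

/-- `g*_t(x) = (1/h^{-1}(1/t)) ∧ (t h(|x|)/|x|)`, with the convention `h(0)/0 = ∞`. -/
noncomputable def gstar (h hinv : ℝ → ℝ) (t x : ℝ) : ℝ :=
  if x = 0 then 1 / hinv (1 / t) else min (1 / hinv (1 / t)) (t * h |x| / |x|)

namespace Stmt7

lemma norm_sin_le' (w : ℂ) : ‖Complex.sin w‖ ≤ ‖w‖ * Real.exp ‖w‖ := by
  have h1 := Complex.norm_exp_sub_sum_le_norm_mul_exp (w * Complex.I) 1
  have h2 := Complex.norm_exp_sub_sum_le_norm_mul_exp (-w * Complex.I) 1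
  simp only [Finset.sum_range_one, pow_zero, Nat.factorial_zero, Nat.cast_one, div_one, norm_mul,
    Complex.norm_I, mul_one, norm_neg, pow_one] at h1 h2
  have e : Complex.sin w = ((Complex.exp (-w * Complex.I) - 1) - (Complex.exp (w * Complex.I) - 1))
      * (Complex.I / 2) := by
    rw [Complex.sin]; ring
  rw [e, norm_mul]
  have h3 : ‖Complex.I / 2‖ = 1 / 2 := by simp
  rw [h3]
  have h4 := norm_sub_le (Complex.exp (-w * Complex.I) - 1) (Complex.exp (w * Complex.I) - 1)
  linarith

lemma norm_one_sub_cos_le' (w : ℂ) : ‖1 - Complex.cos w‖ ≤ ‖w‖ ^ 2 * Real.exp ‖w‖ := by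
  have h1 := Complex.norm_exp_sub_sum_le_norm_mul_exp (w * Complex.I) 2
  have h2 := Complex.norm_exp_sub_sum_le_norm_mul_exp (-w * Complex.I) 2
  simp only [Finset.sum_range_succ, Finset.sum_range_zero, pow_zero, Nat.factorial_zero,
    Nat.cast_one, div_one, norm_mul,
    Complex.norm_I, mul_one, norm_neg, pow_one, zero_add, Nat.factorial_one] at h1 h2
  have e : 1 - Complex.cos w = ((Complex.exp (-w * Complex.I) - (1 + -w * Complex.I)) +
      (Complex.exp (w * Complex.I) - (1 + w * Complex.I))) * (-1 / 2) := by
    rw [Complex.cos]; ring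
  rw [e, norm_mul]
  have h3 : ‖(-1 / 2 : ℂ)‖ = 1 / 2 := by simp
  rw [h3]
  have h4 := norm_add_le (Complex.exp (-w * Complex.I) - (1 + -w * Complex.I))
    (Complex.exp (w * Complex.I) - (1 + w * Complex.I))
  linarith

noncomputable def Psi (m : ℝ → ℝ) (z : ℂ) : ℂ := ∫ y : ℝ, (1 - Complex.cos (z * y)) * (m y : ℂ)

noncomputable def phi (m : ℝ → ℝ) (ξ : ℝ) : ℝ := ∫ y : ℝ, (1 - Real.cos (ξ * y)) * m y

/-- standing assumptions on a truncated density -/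
structure Trunc (m : ℝ → ℝ) (ρ : ℝ) : Prop where
  meas : Measurable m
  nonneg : ∀ y, 0 ≤ m y
  pos : 0 < ρ
  supp : ∀ y, ρ < |y| → m y = 0
  int : Integrable (fun y => y ^ 2 * m y)

lemma Trunc.integrable_Psi {m : ℝ → ℝ} {ρ : ℝ} (hm : Trunc m ρ) (z : ℂ) :
    Integrable (fun y : ℝ => (1 - Complex.cos (z * y)) * (m y : ℂ)) := by
  refine Integrable.mono' (hm.int.const_mul (‖z‖ ^ 2 * Real.exp (‖z‖ * ρ))) ?_ ?_
  · have := hm.meas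
    refine Measurable.aestronglyMeasurable ?_
    fun_prop
  · refine Eventually.of_forall fun y => ?_
    by_cases hy : ρ < |y|
    · simp [hm.supp y hy]
    · push Not at hy
      rw [norm_mul, Complex.norm_real, Real.norm_of_nonneg (hm.nonneg y)]
      have h1 := norm_one_sub_cos_le' (z * y)
      rw [norm_mul, Complex.norm_real, Real.norm_eq_abs] at h1
      have h2 : Real.exp (‖z‖ * |y|) ≤ Real.exp (‖z‖ * ρ) := by gcongr
      have h3 : (‖z‖ * |y|) ^ 2 * Real.exp (‖z‖ * |y|) ≤ (‖z‖ * |y|) ^ 2 * Real.exp (‖z‖ * ρ) := by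
        gcongr
      calc _ ≤ ((‖z‖ * |y|) ^ 2 * Real.exp (‖z‖ * ρ)) * m y :=
            mul_le_mul_of_nonneg_right (h1.trans h3) (hm.nonneg y)
        _ = _ := by rw [mul_pow, sq_abs]; ring

lemma Trunc.differentiable_Psi {m : ℝ → ℝ} {ρ : ℝ} (hm : Trunc m ρ) :
    Differentiable ℂ (Psi m) := by
  intro z₀
  have hmm := hm.meas
  have key := hasDerivAt_integral_of_dominated_loc_of_deriv_le (μ := volume) (𝕜 := ℂ)
    (F := fun (z : ℂ) (y : ℝ) => (1 - Complex.cos (z * y)) * (m y : ℂ))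
    (F' := fun (z : ℂ) (y : ℝ) => (Complex.sin (z * y) * y) * (m y : ℂ))
    (x₀ := z₀) (s := Metric.ball z₀ 1)
    (bound := fun y => ((‖z₀‖ + 1) * Real.exp ((‖z₀‖ + 1) * ρ)) * (y ^ 2 * m y))
    (Metric.ball_mem_nhds z₀ one_pos)
    (Eventually.of_forall fun z => (hm.integrable_Psi z).aestronglyMeasurable)
    (hm.integrable_Psi z₀)
    (by refine Measurable.aestronglyMeasurable ?_
        fun_prop)
    (by
      refine Eventually.of_forall fun y z hz => ?_
      by_cases hy : ρ < |y|
      · simp [hm.supp y hy]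
      · push Not at hy
        have hz' : ‖z‖ ≤ ‖z₀‖ + 1 := by
          have : ‖z - z₀‖ < 1 := by simpa [dist_eq_norm] using hz
          have := norm_le_norm_add_norm_sub' z z₀
          linarith
        rw [norm_mul, norm_mul, Complex.norm_real, Complex.norm_real,
          Real.norm_of_nonneg (hm.nonneg y), Real.norm_eq_abs]
        have h1 := norm_sin_le' (z * y)
        rw [norm_mul, Complex.norm_real, Real.norm_eq_abs] at h1
        have h3 : (‖z‖ * |y|) * Real.exp (‖z‖ * |y|) ≤
            ((‖z₀‖ + 1) * |y|) * Real.exp ((‖z₀‖ + 1) * ρ) := by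
          gcongr
        calc _ ≤ ((‖z₀‖ + 1) * |y|) * Real.exp ((‖z₀‖ + 1) * ρ) * |y| * m y := by
              have := hm.nonneg y
              have := h1.trans h3
              gcongr
          _ = ((‖z₀‖ + 1) * Real.exp ((‖z₀‖ + 1) * ρ)) * (|y| ^ 2 * m y) := by ring
          _ = _ := by rw [sq_abs])
    (hm.int.const_mul _)
    (by
      refine Eventually.of_forall fun y z hz => ?_
      have h1 : HasDerivAt (fun z : ℂ => z * (y : ℂ)) (y : ℂ) z := by
        simpa using (hasDerivAt_id z).mul_const (y : ℂ)
      have h2 := ((h1.ccos.const_sub 1).mul_const (m y : ℂ))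
      simpa using h2)
  exact key.2.differentiableAt

lemma Psi_ofReal (m : ℝ → ℝ) (ξ : ℝ) : Psi m ξ = (phi m ξ : ℂ) := by
  unfold Psi phi
  rw [← integral_complex_ofReal]
  congr 1
  ext y
  push_cast
  rfl

lemma Trunc.continuous_phi {m : ℝ → ℝ} {ρ : ℝ} (hm : Trunc m ρ) : Continuous (phi m) := by
  have h1 : Continuous fun ξ : ℝ => (Psi m ξ).re :=
    Complex.continuous_re.comp (hm.differentiable_Psi.continuous.comp Complex.continuous_ofReal)
  simpa [Psi_ofReal] using h1

lemma Trunc.integrable_phi {m : ℝ → ℝ} {ρ : ℝ} (hm : Trunc m ρ) (ξ : ℝ) :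
    Integrable (fun y : ℝ => (1 - Real.cos (ξ * y)) * m y) := by
  have := (hm.integrable_Psi ξ).re
  refine this.congr (Eventually.of_forall fun y => ?_)
  simp only []
  have : ((1 - Complex.cos ((ξ : ℂ) * y)) * (m y : ℂ)) =
    (((1 - Real.cos (ξ * y)) * m y : ℝ) : ℂ) := by push_cast; rfl
  rw [this]
  exact Complex.ofReal_re _

lemma Trunc.phi_nonneg {m : ℝ → ℝ} {ρ : ℝ} (hm : Trunc m ρ) (ξ : ℝ) : 0 ≤ phi m ξ :=
  integral_nonneg fun y => mul_nonneg (by have := Real.cos_le_one (ξ * y); linarith) (hm.nonneg y)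

lemma cosh_sub_one_le (u : ℝ) : Real.cosh u - 1 ≤ u ^ 2 * Real.exp |u| := by
  have h := norm_one_sub_cos_le' ((u : ℂ) * Complex.I)
  rw [Complex.cos_mul_I, ← Complex.ofReal_cosh, ← Complex.ofReal_one, ← Complex.ofReal_sub,
    Complex.norm_real, norm_mul, Complex.norm_I, Complex.norm_real, Real.norm_eq_abs,
    Real.norm_eq_abs, mul_one, sq_abs] at h
  have := neg_abs_le (1 - Real.cosh u)
  linarith

lemma Trunc.re_Psi {m : ℝ → ℝ} {ρ : ℝ} (hm : Trunc m ρ) (ξ η' η : ℝ) (h : |η'| ≤ η) :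
    phi m ξ - η ^ 2 * Real.exp (η * ρ) * (∫ y, y ^ 2 * m y) ≤ (Psi m (ξ + η' * Complex.I)).re := by
  have e1 : (Psi m (ξ + η' * Complex.I)).re =
      ∫ y : ℝ, ((1 - Complex.cos ((ξ + η' * Complex.I) * y)) * (m y : ℂ)).re := by
    have := integral_re (hm.integrable_Psi (ξ + η' * Complex.I))
    exact this.symm
  rw [e1, phi, ← integral_const_mul, ← integral_sub (hm.integrable_phi ξ) (hm.int.const_mul _)]
  refine integral_mono ((hm.integrable_phi ξ).sub (hm.int.const_mul _))
    (hm.integrable_Psi (ξ + η' * Complex.I)).re fun y => ?_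
  have hη : 0 ≤ η := (abs_nonneg _).trans h
  simp only []
  by_cases hy : ρ < |y|
  · simp [hm.supp y hy]
  · push Not at hy
    have e2 : ((1 - Complex.cos ((ξ + η' * Complex.I) * y)) * (m y : ℂ)).re =
        (1 - Real.cos (ξ * y) * Real.cosh (η' * y)) * m y := by
      rw [Complex.re_mul_ofReal]
      congr 1
      have : (ξ + η' * Complex.I) * (y : ℂ) = ((ξ * y : ℝ) : ℂ) + ((η' * y : ℝ) : ℂ) * Complex.I := by
        push_cast; ring
      rw [this, Complex.cos_add_mul_I, ← Complex.ofReal_cos, ← Complex.ofReal_sin,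
        ← Complex.ofReal_cosh, ← Complex.ofReal_sinh]
      simp [Complex.mul_re, Complex.mul_im, Complex.sub_re, -Complex.ofReal_cos, -Complex.ofReal_sin,
        -Complex.ofReal_cosh, -Complex.ofReal_sinh, -Complex.ofReal_mul]
    change _ ≤ ((1 - Complex.cos ((ξ + η' * Complex.I) * y)) * (m y : ℂ)).re
    rw [e2]
    have h1 := cosh_sub_one_le (η' * y)
    have h2 : |η' * y| ≤ η * ρ := by rw [abs_mul]; gcongr
    have h3 : (η' * y) ^ 2 ≤ η ^ 2 * y ^ 2 := by
      rw [mul_pow]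
      have : η' ^ 2 ≤ η ^ 2 := by rw [← sq_abs η']; gcongr
      gcongr
    have h4 : (η' * y) ^ 2 * Real.exp |η' * y| ≤ η ^ 2 * y ^ 2 * Real.exp (η * ρ) := by gcongr
    have h5 := Real.one_le_cosh (η' * y)
    have h6 := Real.cos_le_one (ξ * y)
    have h7 := hm.nonneg y
    have : 1 - Real.cos (ξ * y) - η ^ 2 * y ^ 2 * Real.exp (η * ρ) ≤
      1 - Real.cos (ξ * y) * Real.cosh (η' * y) := by nlinarith
    calc _ = (1 - Real.cos (ξ * y) - η ^ 2 * y ^ 2 * Real.exp (η * ρ)) * m y := by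
            ring
      _ ≤ _ := by gcongr

lemma contour_shift (f : ℂ → ℂ) (hf : Differentiable ℂ f) (η : ℝ) (w : ℝ → ℝ)
    (hw : ∀ ξ η' : ℝ, |η'| ≤ |η| → ‖f (ξ + η' * Complex.I)‖ ≤ w ξ) (hwi : Integrable w)
    (hw1 : Tendsto w atTop (nhds 0)) (hw2 : Tendsto w atBot (nhds 0)) :
    ∫ ξ : ℝ, f ξ = ∫ ξ : ℝ, f (ξ + η * Complex.I) := by
  have hc := hf.continuous
  have i0 : Integrable (fun ξ : ℝ => f ξ) := by
    refine hwi.mono' (by fun_prop) (Eventually.of_forall fun ξ => ?_)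
    simpa using hw ξ 0 (by simp)
  have i1 : Integrable (fun ξ : ℝ => f (ξ + η * Complex.I)) :=
    hwi.mono' (Continuous.aestronglyMeasurable (by fun_prop)) (Eventually.of_forall fun ξ => hw ξ η le_rfl)
  have t0 := intervalIntegral_tendsto_integral i0 tendsto_neg_atTop_atBot tendsto_id
  have t1 := intervalIntegral_tendsto_integral i1 tendsto_neg_atTop_atBot tendsto_id
  have hb : ∀ T : ℝ, ‖∫ y in (0:ℝ)..η, f (T + y * Complex.I)‖ ≤ w T * |η| := by
    intro T
    have := intervalIntegral.norm_integral_le_of_norm_le_const (a := (0:ℝ)) (b := η)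
      (f := fun y : ℝ => f (T + y * Complex.I)) (C := w T) (by
        intro y hy
        refine hw T y ?_
        have : y ∈ Set.uIcc 0 η := Set.uIoc_subset_uIcc hy
        simpa using Set.abs_sub_left_of_mem_uIcc this)
    simpa using this
  have v1 : Tendsto (fun T : ℝ => ∫ y in (0:ℝ)..η, f (T + y * Complex.I)) atTop (nhds 0) := by
    refine squeeze_zero_norm hb ?_
    simpa using hw1.mul_const |η|
  have v2 : Tendsto (fun T : ℝ => ∫ y in (0:ℝ)..η, f ((-T : ℝ) + y * Complex.I)) atTop (nhds 0) := by
    refine squeeze_zero_norm (fun T => hb (-T)) ?_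
    simpa using (hw2.comp tendsto_neg_atTop_atBot).mul_const |η|
  have hz : ∀ T : ℝ, ((((∫ x : ℝ in (-T)..T, f x) - ∫ x : ℝ in (-T)..T, f (x + η * Complex.I)) +
      Complex.I • ∫ y in (0:ℝ)..η, f (T + y * Complex.I)) -
      Complex.I • ∫ y in (0:ℝ)..η, f ((-T : ℝ) + y * Complex.I)) = 0 := by
    intro T
    have := Complex.integral_boundary_rect_eq_zero_of_differentiableOn f ((-T : ℝ) : ℂ)
      ((T : ℂ) + η * Complex.I) hf.differentiableOn
    simpa using this
  have lim := ((t0.sub t1).add (v1.const_smul Complex.I)).sub (v2.const_smul Complex.I)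
  have lim0 : Tendsto (fun T : ℝ => ((((∫ x : ℝ in (-T)..T, f x) - ∫ x : ℝ in (-T)..T, f (x + η * Complex.I)) +
      Complex.I • ∫ y in (0:ℝ)..η, f (T + y * Complex.I)) -
      Complex.I • ∫ y in (0:ℝ)..η, f ((-T : ℝ) + y * Complex.I))) atTop (nhds 0) := by
    simp only [hz]; exact tendsto_const_nhds
  have := tendsto_nhds_unique lim lim0
  simp only [smul_zero, add_zero, sub_zero] at this
  exact sub_eq_zero.mp this

noncomputable def G (φ : ℝ → ℝ) (t : ℝ) (k : ℕ) (x : ℝ) : ℂ :=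
  ∫ ξ : ℝ, (Complex.I * ξ) ^ k * Complex.exp (Complex.I * x * ξ) * (Real.exp (-t * φ ξ) : ℂ)

lemma weight_pt {s Q e ξ : ℝ} (hs : 0 < s) (he : 0 ≤ e) (hQ : (1 + |ξ| / s) ^ 4 * e ≤ Q) {k : ℕ}
    (hk : k ≤ 2) : (|ξ| + s) ^ k * e ≤ Q * s ^ k * (1 + (ξ / s) ^ 2)⁻¹ := by
  have h0 : (ξ / s) ^ 2 = (|ξ| / s) ^ 2 := by rw [div_pow, div_pow, sq_abs]
  have h1 : |ξ| + s = s * (1 + |ξ| / s) := by field_simp; ring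
  rw [h0, h1, mul_pow, ← div_eq_mul_inv, le_div_iff₀ (by positivity)]
  have hu : 0 ≤ |ξ| / s := by positivity
  generalize |ξ| / s = u at *
  have h2 : (1 + u) ^ k ≤ (1 + u) ^ 2 := pow_le_pow_right₀ (by linarith) hk
  have h3 : 1 + u ^ 2 ≤ (1 + u) ^ 2 := by nlinarith
  calc _ = s ^ k * ((1 + u) ^ k * (1 + u ^ 2) * e) := by ring
    _ ≤ s ^ k * ((1 + u) ^ 2 * (1 + u) ^ 2 * e) := by gcongr
    _ = s ^ k * ((1 + u) ^ 4 * e) := by ring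
    _ ≤ s ^ k * Q := by gcongr
    _ = _ := by ring

lemma weight_int {s : ℝ} (hs : 0 < s) : Integrable (fun ξ : ℝ => (1 + (ξ / s) ^ 2)⁻¹) :=
  integrable_inv_one_add_sq.comp_div hs.ne'

lemma weight_integral {s : ℝ} (hs : 0 < s) : ∫ ξ : ℝ, (1 + (ξ / s) ^ 2)⁻¹ = s * Real.pi := by
  rw [Measure.integral_comp_div (fun u : ℝ => (1 + u ^ 2)⁻¹), integral_univ_inv_one_add_sq,
    abs_of_pos hs, smul_eq_mul]

lemma weight_lim1 {s : ℝ} (hs : 0 < s) :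
    Tendsto (fun ξ : ℝ => (1 + (ξ / s) ^ 2)⁻¹) atTop (nhds 0) := by
  apply Tendsto.inv_tendsto_atTop
  apply tendsto_atTop_add_const_left
  exact (tendsto_pow_atTop two_ne_zero).comp (tendsto_id.atTop_div_const hs)

lemma weight_lim2 {s : ℝ} (hs : 0 < s) :
    Tendsto (fun ξ : ℝ => (1 + (ξ / s) ^ 2)⁻¹) atBot (nhds 0) := by
  have := (weight_lim1 hs).comp tendsto_neg_atBot_atTop
  refine this.congr fun ξ => ?_
  simp [neg_div]

lemma norm_exp_I (x ξ : ℝ) : ‖Complex.exp (Complex.I * x * ξ)‖ = 1 := by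
  rw [Complex.norm_exp]; simp

lemma G_integrand_norm (φ : ℝ → ℝ) (t : ℝ) (k : ℕ) (x ξ : ℝ) :
    ‖(Complex.I * ξ) ^ k * Complex.exp (Complex.I * x * ξ) * (Real.exp (-t * φ ξ) : ℂ)‖
      = |ξ| ^ k * Real.exp (-t * φ ξ) := by
  rw [norm_mul, norm_mul, norm_exp_I, norm_pow, norm_mul, Complex.norm_I, Complex.norm_real,
    Complex.norm_real, Real.norm_eq_abs, Real.norm_of_nonneg (Real.exp_pos _).le]
  ring

lemma pow_integrable {φ : ℝ → ℝ} (hφ : Continuous φ) {t s Q : ℝ} (hs : 0 < s)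
    (hQ : ∀ ξ, (1 + |ξ| / s) ^ 4 * Real.exp (-t * φ ξ) ≤ Q) {k : ℕ} (hk : k ≤ 2) :
    Integrable (fun ξ => |ξ| ^ k * Real.exp (-t * φ ξ)) ∧
    ∫ ξ, |ξ| ^ k * Real.exp (-t * φ ξ) ≤ Q * s ^ (k + 1) * Real.pi := by
  have hle : ∀ ξ, |ξ| ^ k * Real.exp (-t * φ ξ) ≤ Q * s ^ k * (1 + (ξ / s) ^ 2)⁻¹ := by
    intro ξ
    refine le_trans ?_ (weight_pt hs (Real.exp_pos _).le (hQ ξ) hk)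
    gcongr
    linarith
  have hi : Integrable (fun ξ => |ξ| ^ k * Real.exp (-t * φ ξ)) := by
    refine ((weight_int hs).const_mul (Q * s ^ k)).mono'
      (Continuous.aestronglyMeasurable (by fun_prop)) (Eventually.of_forall fun ξ => ?_)
    rw [Real.norm_of_nonneg (by positivity)]
    exact hle ξ
  refine ⟨hi, ?_⟩
  calc _ ≤ ∫ ξ, Q * s ^ k * (1 + (ξ / s) ^ 2)⁻¹ :=
        integral_mono hi ((weight_int hs).const_mul (Q * s ^ k)) hle
    _ = _ := by rw [integral_const_mul, weight_integral hs]; ring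

lemma G_integrable {φ : ℝ → ℝ} (hφ : Continuous φ) {t s Q : ℝ} (hs : 0 < s)
    (hQ : ∀ ξ, (1 + |ξ| / s) ^ 4 * Real.exp (-t * φ ξ) ≤ Q) {k : ℕ} (hk : k ≤ 2) (x : ℝ) :
    Integrable (fun ξ : ℝ => (Complex.I * ξ) ^ k * Complex.exp (Complex.I * x * ξ) *
      (Real.exp (-t * φ ξ) : ℂ)) := by
  refine (pow_integrable hφ hs hQ hk).1.mono'
      (Continuous.aestronglyMeasurable (by fun_prop)) (Eventually.of_forall fun ξ => ?_)
  rw [G_integrand_norm]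

lemma G_hasDerivAt {φ : ℝ → ℝ} (hφ : Continuous φ) {t s Q : ℝ} (hs : 0 < s)
    (hQ : ∀ ξ, (1 + |ξ| / s) ^ 4 * Real.exp (-t * φ ξ) ≤ Q) {k : ℕ} (hk : k + 1 ≤ 2) (x : ℝ) :
    HasDerivAt (G φ t k) (G φ t (k + 1) x) x := by
  have key := hasDerivAt_integral_of_dominated_loc_of_deriv_le (μ := volume) (𝕜 := ℝ)
    (F := fun (x : ℝ) (ξ : ℝ) => (Complex.I * ξ) ^ k * Complex.exp (Complex.I * x * ξ) *
      (Real.exp (-t * φ ξ) : ℂ))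
    (F' := fun (x : ℝ) (ξ : ℝ) => (Complex.I * ξ) ^ (k + 1) * Complex.exp (Complex.I * x * ξ) *
      (Real.exp (-t * φ ξ) : ℂ))
    (x₀ := x) (s := Set.univ)
    (bound := fun ξ => |ξ| ^ (k + 1) * Real.exp (-t * φ ξ))
    univ_mem
    (Eventually.of_forall fun z => (G_integrable hφ hs hQ (by omega) z).aestronglyMeasurable)
    (G_integrable hφ hs hQ (by omega) x)
    (G_integrable hφ hs hQ hk x).aestronglyMeasurable
    (Eventually.of_forall fun ξ z _ => (G_integrand_norm φ t (k + 1) z ξ).le)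
    (pow_integrable hφ hs hQ hk).1
    (by
      refine Eventually.of_forall fun ξ z _ => ?_
      have h1 : HasDerivAt (fun z : ℝ => Complex.I * (z : ℂ) * (ξ : ℂ)) (Complex.I * 1 * ξ) z :=
        ((Complex.ofRealCLM.hasDerivAt (x := z)).const_mul Complex.I).mul_const (ξ : ℂ)
      have h2 := (h1.cexp.const_mul ((Complex.I * ξ) ^ k)).mul_const (Real.exp (-t * φ ξ) : ℂ)
      refine h2.congr_deriv ?_
      ring)
  exact key.2

lemma Trunc.G_bound {m : ℝ → ℝ} {ρ : ℝ} (hm : Trunc m ρ) {t s Q : ℝ} (ht : 0 ≤ t) (hs : 0 < s)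
    (hQ : ∀ ξ, (1 + |ξ| / s) ^ 4 * Real.exp (-t * phi m ξ) ≤ Q) {k : ℕ} (hk : k ≤ 2)
    {η : ℝ} (hη : 0 ≤ η) (hηs : η ≤ s) (x : ℝ) :
    ‖G (phi m) t k x‖ ≤
      Real.exp (-(|x| * η) + t * (η ^ 2 * Real.exp (η * ρ) * ∫ y, y ^ 2 * m y)) *
        (Q * s ^ (k + 1) * Real.pi) := by
  set B := η ^ 2 * Real.exp (η * ρ) * ∫ y, y ^ 2 * m y with hB
  obtain ⟨σ, hσ, hxσ⟩ : ∃ σ : ℝ, |σ| = η ∧ x * σ = |x| * η := by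
    rcases le_total 0 x with h | h
    · exact ⟨η, abs_of_nonneg hη, by rw [abs_of_nonneg h]⟩
    · exact ⟨-η, by rw [abs_neg, abs_of_nonneg hη], by rw [abs_of_nonpos h]; ring⟩
  set f : ℂ → ℂ := fun z => (Complex.I * z) ^ k * Complex.exp (Complex.I * x * z) *
    Complex.exp (-t * Psi m z) with hf
  have hfd : Differentiable ℂ f := by
    have := hm.differentiable_Psi
    rw [hf]; fun_prop
  have hnorm : ∀ ξ η' : ℝ, |η'| ≤ η → ‖f (ξ + η' * Complex.I)‖ ≤
      Real.exp (-(x * η') + t * B) * (Q * s ^ k * (1 + (ξ / s) ^ 2)⁻¹) := by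
    intro ξ η' h'
    have h1 := hm.re_Psi ξ η' η h'
    rw [← hB] at h1
    have h2 : ‖(ξ : ℂ) + η' * Complex.I‖ ≤ |ξ| + s := by
      refine (norm_add_le _ _).trans ?_
      rw [norm_mul, Complex.norm_I, Complex.norm_real, Complex.norm_real, Real.norm_eq_abs,
        Real.norm_eq_abs]
      linarith
    have h3 : ‖f (ξ + η' * Complex.I)‖ = ‖(ξ : ℂ) + η' * Complex.I‖ ^ k * Real.exp (-(x * η')) *
        Real.exp (-t * (Psi m (ξ + η' * Complex.I)).re) := by
      rw [hf]
      simp only [norm_mul, norm_pow, Complex.norm_I, one_mul, Complex.norm_exp]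
      congr 2
      · congr 1
        simp
      · simp [← Complex.ofReal_neg]
    rw [h3]
    have h4 : Real.exp (-t * (Psi m (ξ + η' * Complex.I)).re) ≤
        Real.exp (t * B) * Real.exp (-t * phi m ξ) := by
      rw [← Real.exp_add]
      apply Real.exp_le_exp.mpr
      nlinarith
    calc _ ≤ (|ξ| + s) ^ k * Real.exp (-(x * η')) *
          (Real.exp (t * B) * Real.exp (-t * phi m ξ)) := by gcongr
      _ = Real.exp (-(x * η') + t * B) * ((|ξ| + s) ^ k * Real.exp (-t * phi m ξ)) := by
          rw [Real.exp_add]; ring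
      _ ≤ _ := by
          exact mul_le_mul_of_nonneg_left (weight_pt hs (Real.exp_pos _).le (hQ ξ) hk)
            (Real.exp_pos _).le
  have hQ0 : 0 ≤ Q := le_trans (by positivity) (hQ 0)
  have hshift := contour_shift f hfd σ
    (fun ξ => Real.exp (|x| * η + t * B) * (Q * s ^ k * (1 + (ξ / s) ^ 2)⁻¹))
    (by
      intro ξ η' h'
      rw [hσ] at h'
      refine (hnorm ξ η' h').trans ?_
      gcongr
      have : |x * η'| ≤ |x| * η := by rw [abs_mul]; gcongr
      have := neg_abs_le (x * η')
      linarith)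
    (((weight_int hs).const_mul _).const_mul _)
    (by simpa using ((weight_lim1 hs).const_mul (Q * s ^ k)).const_mul (Real.exp (|x| * η + t * B)))
    (by simpa using ((weight_lim2 hs).const_mul (Q * s ^ k)).const_mul (Real.exp (|x| * η + t * B)))
  have hG : G (phi m) t k x = ∫ ξ : ℝ, f ξ := by
    unfold G
    congr 1
    ext ξ
    rw [hf]
    simp only [Psi_ofReal]
    push_cast
    rfl
  rw [hG, hshift]
  have := norm_integral_le_of_norm_le (((weight_int hs).const_mul (Q * s ^ k)).const_mul
    (Real.exp (-(x * σ) + t * B))) (Eventually.of_forall fun ξ => hnorm ξ σ hσ.le)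
  refine this.trans (le_of_eq ?_)
  rw [integral_const_mul, integral_const_mul, weight_integral hs, hxσ]
  ring

lemma G_one_re {φ : ℝ → ℝ} (hφ : Continuous φ) {t s Q : ℝ} (hs : 0 < s)
    (hQ : ∀ ξ, (1 + |ξ| / s) ^ 4 * Real.exp (-t * φ ξ) ≤ Q) (x : ℝ) :
    |(G φ t 1 x).re| ≤ |x| * (Q * s ^ 3 * Real.pi) := by
  have h0 : (G φ t 1 0).re = 0 := by
    have e : (G φ t 1 0).re = ∫ ξ : ℝ, ((Complex.I * ξ) ^ 1 * Complex.exp (Complex.I * (0:ℝ) * ξ) *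
      (Real.exp (-t * φ ξ) : ℂ)).re := (integral_re (G_integrable hφ hs hQ (by norm_num) 0)).symm
    rw [e]
    have : ∀ ξ : ℝ, ((Complex.I * ξ) ^ 1 * Complex.exp (Complex.I * (0:ℝ) * ξ) *
      (Real.exp (-t * φ ξ) : ℂ)).re = 0 := by
      intro ξ
      rw [Complex.re_mul_ofReal]
      simp
    simp only [this, integral_zero]
  have h2 := pow_integrable hφ hs hQ (k := 2) le_rfl
  have h1 : ‖G φ t 1 x - G φ t 1 0‖ ≤ |x| * (Q * s ^ 3 * Real.pi) := by
    have := (convex_univ (𝕜 := ℝ) (E := ℝ)).norm_image_sub_le_of_norm_hasDerivWithin_le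
      (f := G φ t 1) (f' := fun y => G φ t 2 y) (C := Q * s ^ 3 * Real.pi) (x := 0) (y := x)
      (fun y _ => (G_hasDerivAt hφ hs hQ (k := 1) (by norm_num) y).hasDerivWithinAt)
      (fun y _ => by
        refine le_trans (norm_integral_le_integral_norm _) ?_
        simp only [G_integrand_norm]
        exact h2.2) (Set.mem_univ _) (Set.mem_univ _)
    rw [mul_comm]
    simpa using this
  calc _ = |(G φ t 1 x - G φ t 1 0).re| := by rw [Complex.sub_re, h0, sub_zero]
    _ ≤ _ := (Complex.abs_re_le_norm _).trans h1

lemma G_diff {φ ψ : ℝ → ℝ} (hφ : Continuous φ) (hψ : Continuous ψ) {t s Q N : ℝ} (ht : 0 ≤ t)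
    (hs : 0 < s)
    (hQ : ∀ ξ, (1 + |ξ| / s) ^ 4 * Real.exp (-t * φ ξ) ≤ Q)
    (h1 : ∀ ξ, φ ξ ≤ ψ ξ) (h2 : ∀ ξ, ψ ξ - φ ξ ≤ N) (x : ℝ) :
    ‖G ψ t 1 x‖ ≤ ‖G φ t 1 x‖ + t * N * (Q * s ^ 2 * Real.pi) := by
  have hQ' : ∀ ξ, (1 + |ξ| / s) ^ 4 * Real.exp (-t * ψ ξ) ≤ Q := by
    intro ξ
    refine le_trans ?_ (hQ ξ)
    have := h1 ξ
    gcongr ?_ * Real.exp ?_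
    nlinarith
  have hp := pow_integrable hφ hs hQ (k := 1) (by norm_num)
  have hN : 0 ≤ N := by have := h1 0; have := h2 0; linarith
  have : ‖G ψ t 1 x - G φ t 1 x‖ ≤ t * N * (Q * s ^ 2 * Real.pi) := by
    unfold G
    rw [← integral_sub (G_integrable hψ hs hQ' (by norm_num) x)
      (G_integrable hφ hs hQ (by norm_num) x)]
    refine (norm_integral_le_of_norm_le (hp.1.const_mul (t * N))
      (Eventually.of_forall fun ξ => ?_)).trans ?_
    · rw [← mul_sub, norm_mul, norm_mul, norm_exp_I, norm_pow, norm_mul, Complex.norm_I,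
        Complex.norm_real, ← Complex.ofReal_sub, Complex.norm_real, Real.norm_eq_abs,
        Real.norm_eq_abs]
      have e : Real.exp (-t * ψ ξ) = Real.exp (-t * φ ξ) * Real.exp (-(t * (ψ ξ - φ ξ))) := by
        rw [← Real.exp_add]; congr 1; ring
      have a1 := Real.add_one_le_exp (-(t * (ψ ξ - φ ξ)))
      have a2 : 0 ≤ t * (ψ ξ - φ ξ) := mul_nonneg ht (by have := h1 ξ; linarith)
      have a3 : Real.exp (-(t * (ψ ξ - φ ξ))) ≤ 1 := Real.exp_le_one_iff.mpr (by linarith)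
      have a4 : t * (ψ ξ - φ ξ) ≤ t * N := mul_le_mul_of_nonneg_left (h2 ξ) ht
      have a5 : |Real.exp (-t * ψ ξ) - Real.exp (-t * φ ξ)| ≤ Real.exp (-t * φ ξ) * (t * N) := by
        have : Real.exp (-t * ψ ξ) - Real.exp (-t * φ ξ) =
          -(Real.exp (-t * φ ξ) * (1 - Real.exp (-(t * (ψ ξ - φ ξ))))) := by rw [e]; ring
        rw [this, abs_neg, abs_of_nonneg (mul_nonneg (Real.exp_pos _).le (by linarith))]
        gcongr
        linarith
      calc _ = |ξ| ^ 1 * |Real.exp (-t * ψ ξ) - Real.exp (-t * φ ξ)| := by ring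
        _ ≤ |ξ| ^ 1 * (Real.exp (-t * φ ξ) * (t * N)) := by gcongr
        _ = _ := by ring
    · rw [integral_const_mul]
      exact mul_le_mul_of_nonneg_left hp.2 (mul_nonneg ht hN)
  have h3 := norm_le_norm_add_norm_sub' (G ψ t 1 x) (G φ t 1 x)
  linarith

structure LH (ν h : ℝ → ℝ) : Prop where
  meas : Measurable ν
  nonneg : ∀ x, 0 ≤ ν x
  int : Integrable (fun x : ℝ => min (x ^ 2) 1 * ν x)
  hdef : ∀ r : ℝ, 0 < r → h r = ∫ x : ℝ, min 1 (x ^ 2 / r ^ 2) * ν x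

lemma LH.int_min {ν h : ℝ → ℝ} (H : LH ν h) {r : ℝ} (hr : 0 < r) :
    Integrable (fun x : ℝ => min 1 (x ^ 2 / r ^ 2) * ν x) := by
  have hm := H.meas
  refine (H.int.const_mul (1 + 1 / r ^ 2)).mono' (Measurable.aestronglyMeasurable (by fun_prop))
    (Eventually.of_forall fun x => ?_)
  rw [Real.norm_of_nonneg (mul_nonneg (by positivity) (H.nonneg x)), ← mul_assoc]
  refine mul_le_mul_of_nonneg_right ?_ (H.nonneg x)
  have hp : 0 < 1 / r ^ 2 := by positivity
  rcases le_total (x ^ 2) 1 with h1 | h1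
  · rw [min_eq_left h1]
    refine (min_le_right _ _).trans ?_
    have := sq_nonneg x
    rw [div_eq_mul_one_div]
    nlinarith
  · rw [min_eq_right h1]
    refine (min_le_left _ _).trans ?_
    linarith

lemma LH.h_nonneg {ν h : ℝ → ℝ} (H : LH ν h) {r : ℝ} (hr : 0 < r) : 0 ≤ h r := by
  rw [H.hdef r hr]
  exact integral_nonneg fun x => mul_nonneg (by positivity) (H.nonneg x)

lemma LH.h_le_sq {ν h : ℝ → ℝ} (H : LH ν h) {r l : ℝ} (hr : 0 < r) (hl : 1 ≤ l) :
    h r ≤ l ^ 2 * h (l * r) := by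
  have hlr : 0 < l * r := by positivity
  rw [H.hdef r hr, H.hdef (l * r) hlr, ← integral_const_mul]
  refine integral_mono (H.int_min hr) ((H.int_min hlr).const_mul _) fun x => ?_
  simp only []
  rw [← mul_assoc]
  refine mul_le_mul_of_nonneg_right ?_ (H.nonneg x)
  rw [mul_min_of_nonneg _ _ (by positivity)]
  apply min_le_min
  · nlinarith
  · apply le_of_eq
    field_simp

lemma LH.int_ind {ν h : ℝ → ℝ} (H : LH ν h) {r : ℝ} (hr : 0 < r) :
    Integrable (Set.indicator {x : ℝ | |x| ≤ r} (fun x => x ^ 2 / r ^ 2 * ν x)) := by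
  have hm := H.meas
  have hS : MeasurableSet {x : ℝ | |x| ≤ r} := measurableSet_le (by fun_prop) (by fun_prop)
  refine (H.int_min hr).mono'
    (((Measurable.indicator (by fun_prop) hS)).aestronglyMeasurable)
    (Eventually.of_forall fun x => ?_)
  have hn := H.nonneg x
  by_cases hx : |x| ≤ r
  · rw [Set.indicator_of_mem (by exact hx), Real.norm_of_nonneg (by positivity)]
    refine mul_le_mul_of_nonneg_right (le_min ?_ le_rfl) hn
    rw [div_le_one (by positivity), ← sq_abs]
    gcongr
  · rw [Set.indicator_of_notMem (by exact hx), norm_zero]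
    exact mul_nonneg (by positivity) hn

lemma LH.h_le_K {ν h : ℝ → ℝ} (H : LH ν h) {l : ℝ} (hl : 1 ≤ l)
    (h2 : ∀ θ, 0 < θ → 2 * h (l * θ) ≤ h θ) {r : ℝ} (hr : 0 < r) :
    h r ≤ l ^ 2 * ∫ x, Set.indicator {x : ℝ | |x| ≤ r} (fun x => x ^ 2 / r ^ 2 * ν x) x := by
  have hl0 : 0 < l := by linarith
  have hrl : 0 < r / l := by positivity
  have e : l * (r / l) = r := by field_simp
  have h3 := h2 (r / l) hrl
  rw [e] at h3
  have h4 : h (r / l) - h r ≤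
      l ^ 2 * ∫ x, Set.indicator {x : ℝ | |x| ≤ r} (fun x => x ^ 2 / r ^ 2 * ν x) x := by
    rw [H.hdef _ hrl, H.hdef r hr, ← integral_const_mul,
      ← integral_sub (H.int_min hrl) (H.int_min hr)]
    refine integral_mono ((H.int_min hrl).sub (H.int_min hr)) ((H.int_ind hr).const_mul _)
      fun x => ?_
    simp only []
    have hn := H.nonneg x
    by_cases hx : |x| ≤ r
    · rw [Set.indicator_of_mem (by exact hx)]
      have a1 : min 1 (x ^ 2 / (r / l) ^ 2) ≤ l ^ 2 * (x ^ 2 / r ^ 2) := by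
        refine (min_le_right _ _).trans (le_of_eq ?_)
        field_simp
      have a2 : 0 ≤ min 1 (x ^ 2 / r ^ 2) := by positivity
      nlinarith
    · rw [Set.indicator_of_notMem (by exact hx)]
      push Not at hx
      have a0 : r ^ 2 ≤ x ^ 2 := by rw [← sq_abs x]; gcongr
      have a1 : 1 ≤ x ^ 2 / r ^ 2 := by rw [one_le_div (by positivity)]; exact a0
      rw [min_eq_left a1, mul_zero]
      have : min 1 (x ^ 2 / (r / l) ^ 2) ≤ 1 := min_le_left _ _
      nlinarith
  linarith

noncomputable def cut (μ : ℝ → ℝ) (ρ : ℝ) : ℝ → ℝ :=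
  Set.indicator {y : ℝ | y ≠ 0 ∧ |y| ≤ ρ} μ

structure MH (ν μ : ℝ → ℝ) (δ : ℝ) : Prop where
  pos : 0 < δ
  meas : Measurable μ
  bd : ∀ x, x ≠ 0 → 0 ≤ μ x ∧ μ x ≤ ν x
  eq : ∀ x, x ≠ 0 → |x| ≤ δ → μ x = ν x
  zero : ∀ x, 2 * δ ≤ |x| → μ x = 0

lemma cut_nonneg {ν μ : ℝ → ℝ} {δ : ℝ} (M : MH ν μ δ) (ρ y : ℝ) : 0 ≤ cut μ ρ y :=
  Set.indicator_nonneg (fun x hx => (M.bd x hx.1).1) y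

lemma cut_le {ν μ h : ℝ → ℝ} {δ : ℝ} (H : LH ν h) (M : MH ν μ δ) (ρ y : ℝ) : cut μ ρ y ≤ ν y :=
  Set.indicator_le' (fun x hx => (M.bd x hx.1).2) (fun x _ => H.nonneg x) y

lemma cut_supp (μ : ℝ → ℝ) {ρ y : ℝ} (h : ρ < |y|) : cut μ ρ y = 0 :=
  Set.indicator_of_notMem (fun hx => absurd hx.2 (not_le.mpr h)) _

lemma cut_meas {ν μ : ℝ → ℝ} {δ : ℝ} (M : MH ν μ δ) (ρ : ℝ) : Measurable (cut μ ρ) := by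
  refine M.meas.indicator ?_
  exact ((measurableSet_singleton (0:ℝ)).compl).inter
    (measurableSet_le (f := fun y : ℝ => |y|) (g := fun _ => ρ) (by fun_prop) (by fun_prop))

lemma cut_sq_le {ν μ h : ℝ → ℝ} {δ : ℝ} (H : LH ν h) (M : MH ν μ δ) {ρ : ℝ} (hρ : 0 < ρ) (y : ℝ) :
    y ^ 2 * cut μ ρ y ≤ ρ ^ 2 * (min 1 (y ^ 2 / ρ ^ 2) * ν y) := by
  have hn := H.nonneg y
  by_cases hy : ρ < |y|
  · rw [cut_supp μ hy]
    simp only [mul_zero]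
    positivity
  · push Not at hy
    have a0 : y ^ 2 ≤ ρ ^ 2 := by rw [← sq_abs y]; gcongr
    rw [min_eq_right (by rw [div_le_one (by positivity)]; exact a0)]
    have := cut_le H M ρ y
    calc _ ≤ y ^ 2 * ν y := by gcongr
      _ = _ := by field_simp

lemma trunc_cut {ν μ h : ℝ → ℝ} {δ : ℝ} (H : LH ν h) (M : MH ν μ δ) {ρ : ℝ} (hρ : 0 < ρ) :
    Trunc (cut μ ρ) ρ where
  meas := cut_meas M ρ
  nonneg := cut_nonneg M ρ
  pos := hρ
  supp := fun y hy => cut_supp μ hy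
  int := by
    have := cut_meas M ρ
    refine ((H.int_min hρ).const_mul (ρ ^ 2)).mono' (Measurable.aestronglyMeasurable (by fun_prop))
      (Eventually.of_forall fun y => ?_)
    rw [Real.norm_of_nonneg (mul_nonneg (sq_nonneg _) (cut_nonneg M ρ y))]
    exact cut_sq_le H M hρ y

lemma cut_second {ν μ h : ℝ → ℝ} {δ : ℝ} (H : LH ν h) (M : MH ν μ δ) {ρ : ℝ} (hρ : 0 < ρ) :
    ∫ y, y ^ 2 * cut μ ρ y ≤ ρ ^ 2 * h ρ := by
  rw [H.hdef ρ hρ, ← integral_const_mul]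
  exact integral_mono (trunc_cut H M hρ).int ((H.int_min hρ).const_mul _) (cut_sq_le H M hρ)

lemma psi_eq {ν μ : ℝ → ℝ} {δ : ℝ} (M : MH ν μ δ) (ξ : ℝ) :
    ∫ y : ℝ, (1 - Real.cos (ξ * y)) * μ y = phi (cut μ (2 * δ)) ξ := by
  unfold phi
  congr 1
  ext y
  by_cases hy : y ≠ 0 ∧ |y| ≤ 2 * δ
  · rw [cut, Set.indicator_of_mem (by exact hy)]
  · rw [cut, Set.indicator_of_notMem (by exact hy), mul_zero]
    by_cases h0 : y = 0
    · simp [h0]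
    · have : 2 * δ < |y| := by
        by_contra h; exact hy ⟨h0, not_lt.mp h⟩
      rw [M.zero y this.le, mul_zero]

lemma cut_mono {ν μ : ℝ → ℝ} {δ : ℝ} (M : MH ν μ δ) (ρ y : ℝ) : cut μ ρ y ≤ cut μ (2 * δ) y := by
  by_cases hy : y ≠ 0 ∧ |y| ≤ ρ
  · by_cases hy2 : |y| ≤ 2 * δ
    · rw [cut, cut, Set.indicator_of_mem (by exact hy), Set.indicator_of_mem (by exact ⟨hy.1, hy2⟩)]
    · rw [cut, Set.indicator_of_mem (by exact hy), M.zero y (not_le.mp hy2).le]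
      exact cut_nonneg M _ y
  · rw [cut, Set.indicator_of_notMem (by exact hy)]
    exact cut_nonneg M _ y

lemma phi_cut_le {ν μ h : ℝ → ℝ} {δ : ℝ} (H : LH ν h) (M : MH ν μ δ) {ρ : ℝ} (hρ : 0 < ρ) (ξ : ℝ) :
    phi (cut μ ρ) ξ ≤ phi (cut μ (2 * δ)) ξ := by
  have hδ := M.pos
  refine integral_mono ((trunc_cut H M hρ).integrable_phi ξ)
    ((trunc_cut H M (ρ := 2 * δ) (by positivity)).integrable_phi ξ) fun y => ?_
  have := Real.cos_le_one (ξ * y)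
  exact mul_le_mul_of_nonneg_left (cut_mono M ρ y) (by linarith)

lemma phi_cut_diff {ν μ h : ℝ → ℝ} {δ : ℝ} (H : LH ν h) (M : MH ν μ δ) {ρ : ℝ} (hρ : 0 < ρ) (ξ : ℝ) :
    phi (cut μ (2 * δ)) ξ - phi (cut μ ρ) ξ ≤ 2 * h ρ := by
  have hδ := M.pos
  have i1 := (trunc_cut H M hρ).integrable_phi ξ
  have i2 := (trunc_cut H M (ρ := 2 * δ) (by positivity)).integrable_phi ξ
  unfold phi
  rw [H.hdef ρ hρ, ← integral_const_mul, ← integral_sub i2 i1]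
  refine integral_mono (i2.sub i1) ((H.int_min hρ).const_mul _) fun y => ?_
  simp only []
  have hn := H.nonneg y
  have c1 := Real.cos_le_one (ξ * y)
  have c2 := Real.neg_one_le_cos (ξ * y)
  by_cases hy : ρ < |y|
  · rw [cut_supp μ hy, mul_zero, sub_zero]
    have a0 : ρ ^ 2 ≤ y ^ 2 := by rw [← sq_abs y]; gcongr
    rw [min_eq_left (by rw [one_le_div (by positivity)]; exact a0), one_mul]
    have := cut_le H M (2 * δ) y
    have := cut_nonneg M (2 * δ) y
    calc _ ≤ (2:ℝ) * cut μ (2 * δ) y := by gcongr; linarith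
      _ ≤ _ := by gcongr
  · push Not at hy
    have : cut μ (2 * δ) y ≤ cut μ ρ y := by
      by_cases hy2 : y ≠ 0 ∧ |y| ≤ 2 * δ
      · rw [cut, cut, Set.indicator_of_mem (by exact hy2), Set.indicator_of_mem (by exact ⟨hy2.1, hy⟩)]
      · rw [cut, Set.indicator_of_notMem (by exact hy2)]
        exact cut_nonneg M _ y
    have h1 : (1 - Real.cos (ξ * y)) * cut μ (2 * δ) y ≤ (1 - Real.cos (ξ * y)) * cut μ ρ y :=
      mul_le_mul_of_nonneg_left this (by linarith)
    have h2 : 0 ≤ 2 * (min 1 (y ^ 2 / ρ ^ 2) * ν y) := by positivity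
    linarith

lemma one_sub_cos_ge {u : ℝ} (hu : |u| ≤ 1) : u ^ 2 / 4 ≤ 1 - Real.cos u := by
  have h1 := (abs_le.mp (Real.cos_bound hu)).2
  have h2 : |u| ^ 4 ≤ u ^ 2 := by
    rw [← sq_abs u]
    exact pow_le_pow_of_le_one (abs_nonneg _) hu (by norm_num)
  have := sq_nonneg u
  linarith

lemma phi_lower {ν μ h : ℝ → ℝ} {δ : ℝ} (H : LH ν h) (M : MH ν μ δ) {l : ℝ} (hl : 1 ≤ l)
    (h2 : ∀ θ, 0 < θ → 2 * h (l * θ) ≤ h θ) {ρ : ℝ} (hρ : 0 < ρ) {ξ : ℝ} (hξ : ξ ≠ 0)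
    (hξδ : 1 / |ξ| ≤ δ) (hξρ : 1 / |ξ| ≤ ρ) :
    h (1 / |ξ|) / (4 * l ^ 2) ≤ phi (cut μ ρ) ξ := by
  have hx : 0 < |ξ| := abs_pos.mpr hξ
  have hr : 0 < 1 / |ξ| := by positivity
  have h3 := H.h_le_K hl h2 hr
  have h4 : (1 / 4) * (∫ x, Set.indicator {x : ℝ | |x| ≤ 1 / |ξ|}
      (fun x => x ^ 2 / (1 / |ξ|) ^ 2 * ν x) x) ≤ phi (cut μ ρ) ξ := by
    rw [← integral_const_mul]
    refine integral_mono ((H.int_ind hr).const_mul _) ((trunc_cut H M hρ).integrable_phi ξ)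
      fun y => ?_
    simp only []
    by_cases hy : |y| ≤ 1 / |ξ|
    · rw [Set.indicator_of_mem (by exact hy)]
      by_cases h0 : y = 0
      · simp [h0]
      · rw [cut, Set.indicator_of_mem (by exact ⟨h0, hy.trans hξρ⟩), M.eq y h0 (hy.trans hξδ)]
        have hu : |ξ * y| ≤ 1 := by
          rw [abs_mul]
          rw [le_div_iff₀ hx] at hy
          linarith
        have := one_sub_cos_ge hu
        have e : 1 / 4 * (y ^ 2 / (1 / |ξ|) ^ 2 * ν y) = ((ξ * y) ^ 2 / 4) * ν y := by
          rw [div_pow, sq_abs]; field_simp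
        rw [e]
        exact mul_le_mul_of_nonneg_right this (H.nonneg y)
    · rw [Set.indicator_of_notMem (by exact hy), mul_zero]
      have c1 := Real.cos_le_one (ξ * y)
      exact mul_nonneg (by linarith) (cut_nonneg M ρ y)
  rw [div_le_iff₀ (by positivity)]
  refine h3.trans ?_
  have : 0 < l ^ 2 := by positivity
  nlinarith

lemma exp_weight (α c : ℝ) (hα : 0 < α) (hc : 0 < c) :
    ∃ Q : ℝ, 16 ≤ Q ∧ ∀ u : ℝ, 1 ≤ u → (1 + u) ^ 4 * Real.exp (-(c * u ^ α)) ≤ Q := by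
  obtain ⟨n, hn⟩ := exists_nat_ge (4 / α)
  refine ⟨16 + 16 * (n.factorial / c ^ n), by
    have : 0 ≤ 16 * ((n.factorial : ℝ) / c ^ n) := by positivity
    linarith, fun u hu => ?_⟩
  have hu0 : 0 < u := by linarith
  have h1 : (1 + u) ^ 4 ≤ 16 * u ^ 4 := by
    calc (1 + u) ^ 4 ≤ (2 * u) ^ 4 := by gcongr; linarith
      _ = _ := by ring
  have h2 : u ^ 4 ≤ (u ^ α) ^ n := by
    rw [← Real.rpow_natCast (u ^ α) n, ← Real.rpow_mul hu0.le, ← Real.rpow_natCast u 4]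
    apply Real.rpow_le_rpow_of_exponent_le hu
    rw [div_le_iff₀ hα] at hn
    push_cast
    linarith
  have h3 := Real.pow_div_factorial_le_exp (c * u ^ α) (by positivity) n
  rw [mul_pow, div_le_iff₀ (by positivity)] at h3
  have h4 : (u ^ α) ^ n ≤ n.factorial / c ^ n * Real.exp (c * u ^ α) := by
    rw [div_mul_eq_mul_div, le_div_iff₀ (by positivity)]
    linarith
  rw [Real.exp_neg, ← div_eq_mul_inv, div_le_iff₀ (Real.exp_pos _)]
  have h5 : 0 < Real.exp (c * u ^ α) := Real.exp_pos _
  nlinarith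

lemma expo_le {ν μ h : ℝ → ℝ} {δ : ℝ} (H : LH ν h) (M : MH ν μ δ) {ρ η t : ℝ} (hρ : 0 < ρ)
    (hη : 0 ≤ η) (ht : 0 ≤ t) :
    t * (η ^ 2 * Real.exp (η * ρ) * ∫ y, y ^ 2 * cut μ ρ y) ≤
      t * (2 * h ρ * Real.exp (2 * (η * ρ))) := by
  refine mul_le_mul_of_nonneg_left ?_ ht
  have h1 := cut_second H M hρ
  have h2 : (η * ρ) ^ 2 ≤ 2 * Real.exp (η * ρ) := by
    have := Real.pow_div_factorial_le_exp (η * ρ) (by positivity) 2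
    simp only [Nat.factorial, Nat.cast_ofNat, mul_one, Nat.succ_eq_add_one, zero_add, Nat.reduceAdd
      ] at this
    linarith
  have h3 := H.h_nonneg hρ
  calc _ ≤ η ^ 2 * Real.exp (η * ρ) * (ρ ^ 2 * h ρ) := by gcongr
    _ = (η * ρ) ^ 2 * (Real.exp (η * ρ) * h ρ) := by ring
    _ ≤ 2 * Real.exp (η * ρ) * (Real.exp (η * ρ) * h ρ) := by gcongr
    _ = _ := by rw [two_mul (η * ρ), Real.exp_add]; ring

lemma g_eq {φ : ℝ → ℝ} (hφ : Continuous φ) {t s Q : ℝ} (hs : 0 < s)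
    (hQ : ∀ ξ, (1 + |ξ| / s) ^ 4 * Real.exp (-t * φ ξ) ≤ Q) (x : ℝ) :
    ∫ ξ : ℝ, Real.cos (x * ξ) * Real.exp (-t * φ ξ) = (G φ t 0 x).re := by
  have e : (G φ t 0 x).re = ∫ ξ : ℝ, ((Complex.I * ξ) ^ 0 * Complex.exp (Complex.I * x * ξ) *
      (Real.exp (-t * φ ξ) : ℂ)).re := (integral_re (G_integrable hφ hs hQ (by norm_num) x)).symm
  rw [e]
  congr 1
  ext ξ
  rw [Complex.re_mul_ofReal, pow_zero, one_mul, Complex.exp_re]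
  simp

lemma scale_Q {ν μ h : ℝ → ℝ} {δ α C₁ : ℝ} (H : LH ν h) (M : MH ν μ δ) (hα : 0 < α) (hC₁ : 0 < C₁)
    (hlsc : ∀ θ : ℝ, 0 < θ → ∀ l : ℝ, 1 ≤ l → C₁ * l ^ α * h (l * θ) ≤ h θ) :
    ∃ Q : ℝ, 0 < Q ∧ ∀ t r E ρ : ℝ, 0 < t → 0 < r → h r = 1 / t → 1 ≤ E → 0 < ρ →
      1 / δ ≤ E / r → 1 / ρ ≤ E / r →
      ∀ ξ, (1 + |ξ| / (E / r)) ^ 4 * Real.exp (-t * phi (cut μ ρ) ξ) ≤ Q := by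
  obtain ⟨l, hl, hl2⟩ : ∃ l : ℝ, 1 ≤ l ∧ 2 ≤ C₁ * l ^ α := by
    refine ⟨max 1 ((2 / C₁) ^ (1 / α)), le_max_left _ _, ?_⟩
    have h1 : 2 / C₁ ≤ (max 1 ((2 / C₁) ^ (1 / α))) ^ α := by
      calc 2 / C₁ = ((2 / C₁) ^ (1 / α)) ^ α := by
            rw [← Real.rpow_mul (by positivity), one_div_mul_cancel hα.ne', Real.rpow_one]
        _ ≤ _ := by
            apply Real.rpow_le_rpow (by positivity) (le_max_right _ _) hα.le
    rw [div_le_iff₀ hC₁] at h1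
    linarith
  have h2 : ∀ θ, 0 < θ → 2 * h (l * θ) ≤ h θ := by
    intro θ hθ
    refine le_trans ?_ (hlsc θ hθ l hl)
    have := H.h_nonneg (r := l * θ) (by positivity)
    gcongr
  have hc : 0 < C₁ / (4 * l ^ 2) := by positivity
  obtain ⟨Q, hQ16, hQ⟩ := exp_weight α (C₁ / (4 * l ^ 2)) hα hc
  refine ⟨Q, by linarith, ?_⟩
  intro t r E ρ ht hr hhr hE hρ hsδ hsρ ξ
  have hδ := M.pos
  set s := E / r with hs
  have hs0 : 0 < s := by positivity
  have hphi := (trunc_cut H M hρ).phi_nonneg ξ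
  rcases le_total (|ξ| / s) 1 with hu | hu
  · have hu0 : 0 ≤ |ξ| / s := by positivity
    have a1 : (1 + |ξ| / s) ^ 4 ≤ (1 + 1) ^ 4 := by gcongr
    have a2 : Real.exp (-t * phi (cut μ ρ) ξ) ≤ 1 := Real.exp_le_one_iff.mpr (by nlinarith)
    calc _ ≤ (1 + 1 : ℝ) ^ 4 * 1 := by gcongr
      _ ≤ Q := by linarith
  · refine le_trans ?_ (hQ _ hu)
    gcongr
    rw [neg_mul]
    apply neg_le_neg
    have hsx : s ≤ |ξ| := by rwa [one_le_div hs0] at hu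
    have hx0 : 0 < |ξ| := hs0.trans_le hsx
    have hinv : 1 / |ξ| ≤ 1 / s := one_div_le_one_div_of_le hs0 hsx
    have b1 : 1 / s ≤ δ := by rw [one_div_le hs0 hδ]; exact hsδ
    have b2 : 1 / s ≤ ρ := by rw [one_div_le hs0 hρ]; exact hsρ
    have low := phi_lower H M hl h2 hρ (abs_pos.mp hx0) (hinv.trans b1) (hinv.trans b2)
    have hux : |ξ| / s ≤ r * |ξ| := by
      rw [hs, div_div_eq_mul_div, mul_comm]
      exact div_le_self (by positivity) hE
    have hsc := hlsc (1 / |ξ|) (by positivity) (r * |ξ|) (hu.trans hux)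
    have e : r * |ξ| * (1 / |ξ|) = r := by field_simp
    rw [e, hhr] at hsc
    have b3 : (|ξ| / s) ^ α ≤ (r * |ξ|) ^ α := Real.rpow_le_rpow (by positivity) hux hα.le
    have b4 : C₁ * (r * |ξ|) ^ α ≤ t * h (1 / |ξ|) := by
      rw [mul_one_div, div_le_iff₀ ht] at hsc
      linarith
    calc C₁ / (4 * l ^ 2) * (|ξ| / s) ^ α ≤ C₁ / (4 * l ^ 2) * (r * |ξ|) ^ α := by gcongr
      _ = (C₁ * (r * |ξ|) ^ α) / (4 * l ^ 2) := by ring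
      _ ≤ (t * h (1 / |ξ|)) / (4 * l ^ 2) := by gcongr
      _ = t * (h (1 / |ξ|) / (4 * l ^ 2)) := by ring
      _ ≤ _ := by gcongr

end Stmt7

set_option maxHeartbeats 4000000 in
/-- bounds on the heat kernel `g_t^{(δ)}` of the truncated process and on
its first and second space derivatives. -/
theorem stmt_7 (ν ν' μ μ' : ℝ → ℝ) (h hinv ψδ : ℝ → ℝ) (g : ℝ → ℝ → ℝ)
    (α β C₁ C₂ η₄ δ0 δ : ℝ)
    (hα : 0 < α) (hαβ : α ≤ β) (hβ : β < 2) (hC₁ : 0 < C₁) (hC₂ : 0 < C₂) (hη₄ : 0 < η₄)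
    (hδ0 : 0 < δ0) (hδ0' : δ0 ≤ 1 / 24) (hδpos : 0 < δ) (hδδ0 : δ ≤ δ0)
    -- ν is the density of a symmetric infinite Lévy measure on ℝ
    (hνmeas : Measurable ν)
    (hνnonneg : ∀ x : ℝ, 0 ≤ ν x)
    (hνsymm : ∀ x : ℝ, ν (-x) = ν x)
    (hνint : Integrable (fun x : ℝ => min (x ^ 2) 1 * ν x))
    (hνinf : ¬ Integrable ν)
    -- regularity of ν near 0
    (hν'deriv : ∀ x ∈ Set.Ioo (0:ℝ) η₄, HasDerivAt ν (ν' x) x)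
    (hν'neg : ∀ x ∈ Set.Ioo (0:ℝ) η₄, ν' x < 0)
    (hν'dec : ∀ x y : ℝ, 0 < x → x < y → y < η₄ → -ν' y / y ≤ -ν' x / x)
    -- h and its inverse
    (hdef : ∀ r : ℝ, 0 < r → h r = ∫ x : ℝ, min 1 (x ^ 2 / r ^ 2) * ν x)
    (hcont : ContinuousOn h (Set.Ioi 0))
    (hanti : StrictAntiOn h (Set.Ioi 0))
    (hlim0 : Tendsto h (nhdsWithin 0 (Set.Ioi 0)) atTop)
    (hlimtop : Tendsto h atTop (nhds 0))
    (hinvpos : ∀ s : ℝ, 0 < s → 0 < hinv s)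
    (hinvr : ∀ s : ℝ, 0 < s → h (hinv s) = s)
    (hinvl : ∀ r : ℝ, 0 < r → hinv (h r) = r)
    -- scaling conditions
    (hlsc : ∀ θ : ℝ, 0 < θ → ∀ l : ℝ, 1 ≤ l → C₁ * l ^ α * h (l * θ) ≤ h θ)
    (husc : ∀ θ : ℝ, 0 < θ → θ ≤ 1 → ∀ l : ℝ, 0 < l → l ≤ 1 →
      h (l * θ) ≤ C₂ * l ^ (-β) * h θ)
    -- μ = μ^{(δ)} is a symmetric truncation of ν
    (hμmeas : Measurable μ)
    (hμeq : ∀ x : ℝ, 0 < x → x ≤ δ → μ x = ν x)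
    (hμbound : ∀ x : ℝ, 0 < x → 0 ≤ μ x ∧ μ x ≤ ν x)
    (hμzero : ∀ x : ℝ, 2 * δ ≤ x → μ x = 0)
    (hμsymm : ∀ x : ℝ, μ (-x) = μ x)
    (hμ'deriv : ∀ x : ℝ, 0 < x → HasDerivAt μ (μ' x) x)
    (hμ'nonpos : ∀ x : ℝ, 0 < x → μ' x ≤ 0)
    (hμ'dec : ∀ x y : ℝ, 0 < x → x ≤ y → -μ' y / y ≤ -μ' x / x)
    -- ψδ and the heat kernel g_t^{(δ)}
    (hψδdef : ∀ ξ : ℝ, ψδ ξ = ∫ x : ℝ, (1 - Real.cos (ξ * x)) * μ x)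
    (hgdef : ∀ t : ℝ, 0 < t → ∀ x : ℝ,
      g t x = (2 * Real.pi)⁻¹ * ∫ ξ : ℝ, Real.cos (x * ξ) * Real.exp (-t * ψδ ξ)) :
    ∃ c : ℝ, 0 < c ∧ ∀ t : ℝ, 0 < t → ∀ x : ℝ,
      g t x ≤ c * (min t 1) ^ (|x| / (8 * δ)) * Real.exp (c * t) *
        (1 / hinv (1 / t)) * Real.exp (-|x|) ∧
      |deriv (g t) x| ≤ c * (min t 1) ^ (|x| / (8 * δ)) * Real.exp (c * t) *
        (1 / (hinv (1 / t)) ^ 3) * Real.exp (-|x|) ∧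
      |deriv (deriv (g t)) x| ≤ c * (min t 1) ^ (|x| / (8 * δ)) * Real.exp (c * t) *
        (1 / (hinv (1 / t)) ^ 3 + 1 / (hinv (1 / t)) ^ 5) * Real.exp (-|x|) ∧
      |deriv (g t) x| ≤ c * Real.exp (c * t) * |x| / (hinv (1 / t)) ^ 2 *
        gstar h hinv t x := by
  classical
  have H : Stmt7.LH ν h := ⟨hνmeas, hνnonneg, hνint, hdef⟩
  have M : Stmt7.MH ν μ δ := by
    have habs : ∀ x : ℝ, μ |x| = μ x ∧ ν |x| = ν x := by
      intro x
      rcases abs_choice x with hx | hx <;> rw [hx]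
      · exact ⟨rfl, rfl⟩
      · exact ⟨hμsymm x, hνsymm x⟩
    refine ⟨hδpos, hμmeas, ?_, ?_, ?_⟩
    · intro x hx
      have := hμbound |x| (abs_pos.mpr hx)
      rwa [(habs x).1, (habs x).2] at this
    · intro x hx hxδ
      have := hμeq |x| (abs_pos.mpr hx) hxδ
      rwa [(habs x).1, (habs x).2] at this
    · intro x hx
      have := hμzero |x| hx
      rwa [(habs x).1] at this
  have hψ : ψδ = Stmt7.phi (Stmt7.cut μ (2 * δ)) := by
    funext ξ
    rw [hψδdef, Stmt7.psi_eq M]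
  have hpos : ∀ r, 0 < r → 0 < h r := by
    intro r hr
    have h1 := H.h_nonneg (r := r + 1) (by linarith)
    have h2 := hanti (show r ∈ Set.Ioi 0 from hr) (show r + 1 ∈ Set.Ioi 0 by
      simp only [Set.mem_Ioi]; linarith) (by linarith)
    linarith
  obtain ⟨Q, hQ0, hQ⟩ := Stmt7.scale_Q H M hα hC₁ hlsc
  have h2δ : 0 < 2 * δ := by positivity
  have h1pos := hpos 1 one_pos
  set d := h 1 / (C₁ * α) with hd
  have hd0 : 0 < d := by positivity
  set D := 1 / δ + 5 + 2 * (h 1 + 1) / (8 * δ) with hD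
  have hDδ : 1 / δ ≤ D := by
    have : 0 ≤ 2 * (h 1 + 1) / (8 * δ) := by positivity
    linarith
  have hD4 : 5 ≤ D := by
    have : 0 ≤ 2 * (h 1 + 1) / (8 * δ) := by positivity
    have : 0 ≤ 1 / δ := by positivity
    linarith
  have hDη : 1 + 2 * (h 1 + 1) / (8 * δ) ≤ D := by
    have : 0 ≤ 1 / δ := by positivity
    linarith
  set K := 2 * h (2 * δ) * Real.exp (4 * δ) with hK
  have hK0 : 0 < K := by have := hpos _ h2δ; positivity
  set C0 := (Real.exp K + Real.exp 32 + 32) * (Q * Real.pi * D ^ 3) with hC0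
  have hC0pos : 0 < C0 := by
    have := Real.pi_pos
    positivity
  refine ⟨C0 + (K + 3 * d), by positivity, ?_⟩
  intro t ht x
  set c := C0 + (K + 3 * d) with hc
  set r := hinv (1 / t) with hr
  have ht1 : 0 < 1 / t := by positivity
  have hr0 : 0 < r := hinvpos _ ht1
  have hhr : h r = 1 / t := hinvr _ ht1
  have hthr : t * h r = 1 := by rw [hhr]; field_simp
  set e := Real.exp (d * t) with he
  have he1 : 1 ≤ e := Real.one_le_exp (by positivity)
  have hre : r ≤ e := by
    rcases le_total r 1 with h1 | h1
    · linarith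
    · have h2 := hlsc 1 one_pos r h1
      rw [mul_one, hhr, mul_one_div, div_le_iff₀ ht] at h2
      have h3 : r ^ α ≤ Real.exp (d * t * α) := by
        have h4 : r ^ α ≤ d * t * α := by
          have : d * t * α = h 1 * t / C₁ := by rw [hd]; field_simp
          rw [this, le_div_iff₀ hC₁]
          linarith
        have := Real.add_one_le_exp (d * t * α)
        linarith
      rw [Real.exp_mul] at h3
      exact (Real.rpow_le_rpow_iff hr0.le (Real.exp_pos _).le hα).mp h3
  set E := D * e with hE
  have hD1 : 1 ≤ D := le_trans (by norm_num) hD4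
  have hDE : D ≤ E := le_mul_of_one_le_right (zero_le_one.trans hD1) he1
  have hE1 : 1 ≤ E := hD1.trans hDE
  have hrE : r ≤ E := hre.trans (le_mul_of_one_le_left (zero_le_one.trans he1) hD1)
  set s := E / r with hs
  have hs0 : 0 < s := by positivity
  have hsδ : 1 / δ ≤ s := by
    rw [hs, le_div_iff₀ hr0]
    have : 0 < 1 / δ := by positivity
    calc 1 / δ * r ≤ D * e := by gcongr
      _ = E := rfl
  have hsρ : 1 / (2 * δ) ≤ s := by
    refine le_trans ?_ hsδ
    apply one_div_le_one_div_of_le hδpos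
    linarith
  have hQ1 := hQ t r E (2 * δ) ht hr0 hhr hE1 h2δ hsδ hsρ
  rw [← hs] at hQ1
  have T1 := Stmt7.trunc_cut H M h2δ
  have hφc := T1.continuous_phi
  set φ := Stmt7.phi (Stmt7.cut μ (2 * δ)) with hφ
  -- derivatives
  have hpi : 0 < (2 * Real.pi)⁻¹ := by have := Real.pi_pos; positivity
  have hpi1 : (2 * Real.pi)⁻¹ ≤ 1 := by
    apply inv_le_one_of_one_le₀
    have := Real.pi_gt_three
    linarith
  have hg0 : ∀ y, g t y = (2 * Real.pi)⁻¹ * (Stmt7.G φ t 0 y).re := by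
    intro y
    rw [hgdef t ht y, hψ, Stmt7.g_eq hφc hs0 hQ1]
  have hder : ∀ k : ℕ, k + 1 ≤ 2 → ∀ y, HasDerivAt (fun y => (2 * Real.pi)⁻¹ * (Stmt7.G φ t k y).re)
      ((2 * Real.pi)⁻¹ * (Stmt7.G φ t (k + 1) y).re) y := by
    intro k hk y
    have h1 := Stmt7.G_hasDerivAt hφc hs0 hQ1 hk y
    exact (Complex.reCLM.hasFDerivAt.comp_hasDerivAt y h1).const_mul _
  have hg1 : deriv (g t) = fun y => (2 * Real.pi)⁻¹ * (Stmt7.G φ t 1 y).re := by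
    have : g t = fun y => (2 * Real.pi)⁻¹ * (Stmt7.G φ t 0 y).re := funext hg0
    rw [this]
    funext y
    exact (hder 0 (by norm_num) y).deriv
  have hg2 : deriv (deriv (g t)) x = (2 * Real.pi)⁻¹ * (Stmt7.G φ t 2 x).re := by
    rw [hg1]
    exact (hder 1 (by norm_num) x).deriv
  have habsle : ∀ z : ℝ, |(2 * Real.pi)⁻¹ * z| ≤ |z| := by
    intro z
    rw [abs_mul, abs_of_pos hpi]
    exact mul_le_of_le_one_left (abs_nonneg _) hpi1
  -- constants
  set V := c * Real.exp (c * t) with hV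
  have hVE : (Real.exp K + Real.exp 32 + 32) * Real.exp (K * t) * (Q * Real.pi * E ^ 3) ≤ V := by
    have h1 : (Real.exp K + Real.exp 32 + 32) * Real.exp (K * t) * (Q * Real.pi * E ^ 3)
        = C0 * Real.exp ((K + 3 * d) * t) := by
      have : Real.exp ((K + 3 * d) * t) = Real.exp (K * t) * e ^ 3 := by
        rw [he, ← Real.exp_nat_mul, ← Real.exp_add]
        congr 1
        push_cast
        ring
      rw [this, hC0, hE]
      ring
    rw [h1, hV]
    gcongr
    · rw [hc]; linarith only [show 0 < K + 3 * d by positivity]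
    · rw [hc]; linarith only [hC0pos]
  have hpi0 := Real.pi_pos
  have hV0 : 0 < V := by positivity
  have hV1 : Real.exp (K * (1 + t)) * (Q * Real.pi * E ^ 3) ≤ V := by
    refine le_trans ?_ hVE
    have : Real.exp (K * (1 + t)) = Real.exp K * Real.exp (K * t) := by
      rw [← Real.exp_add]; congr 1; ring
    rw [this]
    gcongr
    have a1 := Real.exp_pos 32
    linarith only [a1]
  have hKt : 1 ≤ Real.exp (K * t) := Real.one_le_exp (by positivity)
  have hV2 : (Real.exp 32 + 32) * (Q * Real.pi * E ^ 3) ≤ V := by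
    refine le_trans ?_ hVE
    have : Real.exp 32 + 32 ≤ (Real.exp K + Real.exp 32 + 32) * Real.exp (K * t) := by
      have a1 := Real.exp_pos 32
      have a2 := Real.exp_pos K
      have a3 : 0 ≤ Real.exp K + Real.exp 32 + 32 := by positivity
      have a4 := le_mul_of_one_le_right a3 hKt
      linarith only [a2, a4]
    gcongr
  have hV3 : Q * Real.pi * E ^ 3 ≤ V := by
    refine le_trans ?_ hV2
    have a1 := Real.exp_pos 32
    have a2 : 0 < Q * Real.pi * E ^ 3 := by positivity
    exact le_mul_of_one_le_left a2.le (by linarith only [a1])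
  have hE23 : E ^ 2 ≤ E ^ 3 := pow_le_pow_right₀ hE1 (by norm_num)
  have hE13 : E ≤ E ^ 3 := le_self_pow₀ hE1 (by norm_num)
  -- main bound
  set τ := min t 1 with hτ
  have hτ0 : 0 < τ := lt_min ht one_pos
  have hlogτ : Real.log τ ≤ 0 := Real.log_nonpos hτ0.le (min_le_right _ _)
  set η := 1 + (-Real.log τ) / (8 * δ) with hη
  have hη0 : 0 ≤ η := by
    have : 0 ≤ (-Real.log τ) / (8 * δ) := div_nonneg (by linarith) (by positivity)
    linarith
  have hlog : -Real.log τ ≤ 2 * (h 1 + 1) * (e / r) := by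
    rcases le_total 1 t with h1 | h1
    · rw [hτ, min_eq_right h1, Real.log_one, neg_zero]
      positivity
    · rw [hτ, min_eq_left h1]
      have h2 : 1 / t ≤ ((h 1 + 1) * (e / r)) ^ 2 := by
        rw [← hhr]
        have h3 : h r ≤ h 1 * (e / r) ^ 2 := by
          have her : 1 ≤ e / r := by rw [one_le_div hr0]; exact hre
          rcases le_total r 1 with h4 | h4
          · have h5 := H.h_le_sq hr0 (l := 1 / r) (by rw [one_le_div hr0]; exact h4)
            rw [one_div_mul_cancel hr0.ne'] at h5
            calc h r ≤ (1 / r) ^ 2 * h 1 := h5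
              _ ≤ (e / r) ^ 2 * h 1 := by gcongr
              _ = _ := by ring
          · have h5 : h r ≤ h 1 := hanti.antitoneOn (Set.mem_Ioi.mpr (one_pos : (0:ℝ) < 1))
              (show r ∈ Set.Ioi 0 from hr0) h4
            have h6 : 1 ≤ (e / r) ^ 2 := one_le_pow₀ her
            exact h5.trans (le_mul_of_one_le_right h1pos.le h6)
        have h4 : h 1 ≤ (h 1 + 1) ^ 2 := by linarith [sq_nonneg (h 1), add_sq (h 1) 1]
        rw [mul_pow]
        exact h3.trans (by gcongr)
      have hZ : 0 < (h 1 + 1) * (e / r) := by positivity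
      have h3 := Real.log_le_log ht1 h2
      rw [Real.log_pow, one_div, Real.log_inv] at h3
      have h4 := Real.log_le_sub_one_of_pos hZ
      push_cast at h3
      linarith
  have hηs : η ≤ s := by
    have h1 : 1 ≤ e / r := by rw [one_le_div hr0]; exact hre
    calc η ≤ 1 * (e / r) + (2 * (h 1 + 1) * (e / r)) / (8 * δ) := by
          rw [hη]; gcongr; linarith
      _ = (1 + 2 * (h 1 + 1) / (8 * δ)) * (e / r) := by ring
      _ ≤ D * (e / r) := by gcongr
      _ = s := by rw [hs, hE]; ring
  set P := τ ^ (|x| / (8 * δ)) * Real.exp (-|x|) with hP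
  have hP0 : 0 ≤ P := by positivity
  have hexp : Real.exp (-(|x| * η) + t * (η ^ 2 * Real.exp (η * (2 * δ)) *
      ∫ y, y ^ 2 * Stmt7.cut μ (2 * δ) y)) ≤ P * Real.exp (K * (1 + t)) := by
    have h1 := Stmt7.expo_le H M h2δ hη0 ht.le
    have h2 : t * (2 * h (2 * δ) * Real.exp (2 * (η * (2 * δ)))) ≤ K * (1 + t) := by
      have h3 : Real.exp (2 * (η * (2 * δ))) = Real.exp (4 * δ) * Real.exp (-Real.log τ / 2) := by
        rw [← Real.exp_add]
        congr 1
        rw [hη]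
        field_simp
        ring
      have h4 : t * Real.exp (-Real.log τ / 2) ≤ 1 + t := by
        rcases le_total 1 t with h1 | h1
        · rw [hτ, min_eq_right h1, Real.log_one]
          simp
        · rw [hτ, min_eq_left h1]
          have h5 : Real.log t ≤ 0 := Real.log_nonpos ht.le h1
          have : t * Real.exp (-Real.log t / 2) = Real.exp (Real.log t / 2) := by
            nth_rewrite 1 [← Real.exp_log ht]
            rw [← Real.exp_add]
            congr 1
            ring
          rw [this]
          have : Real.exp (Real.log t / 2) ≤ 1 := Real.exp_le_one_iff.mpr (by linarith)
          linarith
      rw [h3]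
      calc _ = K * (t * Real.exp (-Real.log τ / 2)) := by rw [hK]; ring
        _ ≤ _ := by gcongr
    have h5 : P = Real.exp (-(|x| * η)) := by
      rw [hP, Real.rpow_def_of_pos hτ0, ← Real.exp_add]
      congr 1
      rw [hη]
      ring
    rw [h5, ← Real.exp_add]
    apply Real.exp_le_exp.mpr
    linarith
  have hmain : ∀ k : ℕ, k ≤ 2 → ‖Stmt7.G φ t k x‖ ≤
      P * Real.exp (K * (1 + t)) * (Q * s ^ (k + 1) * Real.pi) := by
    intro k hk
    refine (T1.G_bound ht.le hs0 hQ1 hk hη0 hηs x).trans ?_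
    gcongr
  have hfin : ∀ k : ℕ, k ≤ 2 → ‖Stmt7.G φ t k x‖ ≤ P * V * (1 / r ^ (k + 1)) := by
    intro k hk
    refine (hmain k hk).trans ?_
    have : Q * s ^ (k + 1) * Real.pi = Q * Real.pi * E ^ (k + 1) * (1 / r ^ (k + 1)) := by
      rw [hs, div_pow]; ring
    rw [this]
    have h1 : E ^ (k + 1) ≤ E ^ 3 := pow_le_pow_right₀ hE1 (by omega)
    calc _ = P * (Real.exp (K * (1 + t)) * (Q * Real.pi * E ^ (k + 1))) * (1 / r ^ (k + 1)) := by ring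
      _ ≤ P * (Real.exp (K * (1 + t)) * (Q * Real.pi * E ^ 3)) * (1 / r ^ (k + 1)) := by gcongr
      _ ≤ _ := by gcongr
  refine ⟨?_, ?_, ?_, ?_⟩
  · rw [hg0]
    calc _ ≤ |(2 * Real.pi)⁻¹ * (Stmt7.G φ t 0 x).re| := le_abs_self _
      _ ≤ |(Stmt7.G φ t 0 x).re| := habsle _
      _ ≤ ‖Stmt7.G φ t 0 x‖ := Complex.abs_re_le_norm _
      _ ≤ P * V * (1 / r ^ (0 + 1)) := hfin 0 (by norm_num)
      _ = _ := by rw [hP, hV, zero_add, pow_one]; ring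
  · rw [hg1]
    have h1 := hmain 1 (by norm_num)
    have h2 : Q * s ^ (1 + 1) * Real.pi ≤ Q * Real.pi * E ^ 3 * (1 / r ^ 3) := by
      have : Q * s ^ (1 + 1) * Real.pi = Q * Real.pi * (E ^ 2 * r) * (1 / r ^ 3) := by
        rw [hs, div_pow]; field_simp; ring
      rw [this]
      have : E ^ 2 * r ≤ E ^ 3 := by
        calc E ^ 2 * r ≤ E ^ 2 * E := by gcongr
          _ = _ := by ring
      gcongr
    calc _ ≤ |(Stmt7.G φ t 1 x).re| := habsle _
      _ ≤ ‖Stmt7.G φ t 1 x‖ := Complex.abs_re_le_norm _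
      _ ≤ P * Real.exp (K * (1 + t)) * (Q * Real.pi * E ^ 3 * (1 / r ^ 3)) :=
          h1.trans (by gcongr)
      _ = P * (Real.exp (K * (1 + t)) * (Q * Real.pi * E ^ 3)) * (1 / r ^ 3) := by ring
      _ ≤ P * V * (1 / r ^ 3) := by gcongr
      _ = _ := by rw [hP, hV]; ring
  · rw [hg2]
    calc _ ≤ |(Stmt7.G φ t 2 x).re| := habsle _
      _ ≤ ‖Stmt7.G φ t 2 x‖ := Complex.abs_re_le_norm _
      _ ≤ P * V * (1 / r ^ (2 + 1)) := hfin 2 le_rfl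
      _ ≤ P * V * (1 / r ^ 3 + 1 / r ^ 5) := by
          gcongr
          have : 0 < 1 / r ^ 5 := by positivity
          norm_num
          positivity
      _ = _ := by rw [hP, hV]; ring
  · rw [hg1]
    have hfirst : |(Stmt7.G φ t 1 x).re| ≤ V * |x| / r ^ 2 * (1 / r) := by
      refine (Stmt7.G_one_re hφc hs0 hQ1 x).trans ?_
      calc _ = (Q * Real.pi * E ^ 3) * (|x| * (1 / r ^ 3)) := by rw [hs, div_pow]; ring
        _ ≤ V * (|x| * (1 / r ^ 3)) := by gcongr
        _ = _ := by field_simp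
    refine (habsle _).trans ?_
    change _ ≤ c * Real.exp (c * t) * |x| / r ^ 2 * gstar h hinv t x
    rw [← hV]
    unfold gstar
    rw [← hr]
    split_ifs with hx0
    · exact hfirst
    · have hx : 0 < |x| := abs_pos.mpr hx0
      rw [mul_min_of_nonneg _ _ (by positivity)]
      refine le_min hfirst ?_
      have hgoal : V * |x| / r ^ 2 * (t * h |x| / |x|) = V * (1 / r ^ 2) * (t * h |x|) := by
        field_simp
      rw [hgoal]
      have hhx := hpos _ hx
      have hs2 : Q * s ^ 2 * Real.pi ≤ Q * Real.pi * E ^ 3 * (1 / r ^ 2) := by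
        have : Q * s ^ 2 * Real.pi = Q * Real.pi * E ^ 2 * (1 / r ^ 2) := by rw [hs, div_pow]; ring
        rw [this]
        gcongr
      rcases le_total |x| r with hxr | hxr
      · have h1 : 1 ≤ t * h |x| := by
          rw [← hthr]
          have := hanti.antitoneOn (show |x| ∈ Set.Ioi 0 from hx) (show r ∈ Set.Ioi 0 from hr0) hxr
          gcongr
        have h2 := (Stmt7.pow_integrable hφc hs0 hQ1 (k := 1) (by norm_num)).2
        have h3 : ‖Stmt7.G φ t 1 x‖ ≤ Q * s ^ 2 * Real.pi := by
          refine le_trans (norm_integral_le_integral_norm _) ?_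
          simp only [Stmt7.G_integrand_norm]
          exact h2
        calc _ ≤ ‖Stmt7.G φ t 1 x‖ := Complex.abs_re_le_norm _
          _ ≤ Q * Real.pi * E ^ 3 * (1 / r ^ 2) * 1 := by rw [mul_one]; exact h3.trans hs2
          _ ≤ V * (1 / r ^ 2) * (t * h |x|) := by gcongr
      · have hρ : 0 < |x| / 4 := by positivity
        have hsx : 1 / (|x| / 4) ≤ s := by
          rw [one_div_div, hs]
          exact div_le_div₀ (by linarith) (by linarith) hr0 hxr
        have hQ2 := hQ t r E (|x| / 4) ht hr0 hhr hE1 hρ hsδ hsx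
        rw [← hs] at hQ2
        have T2 := Stmt7.trunc_cut H M hρ
        have hth0 : 0 < t * h |x| := by positivity
        have hth1 : t * h |x| ≤ 1 := by
          rw [← hthr]
          have := hanti.antitoneOn (show r ∈ Set.Ioi 0 from hr0) (show |x| ∈ Set.Ioi 0 from hx) hxr
          gcongr
        set L := -Real.log (t * h |x|) with hL
        have hL0 : 0 ≤ L := by
          have := Real.log_nonpos hth0.le hth1
          linarith
        have hL1 : L ≤ 2 * (|x| / r) := by
          have h1 := H.h_le_sq hr0 (l := |x| / r) (by rw [one_le_div hr0]; exact hxr)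
          rw [div_mul_cancel₀ _ hr0.ne'] at h1
          have h2 : (t * h |x|)⁻¹ ≤ (|x| / r) ^ 2 := by
            rw [inv_le_iff_one_le_mul₀ hth0, ← hthr]
            calc t * h r ≤ t * ((|x| / r) ^ 2 * h |x|) := by gcongr
              _ = _ := by ring
          have h3 := Real.log_le_log (by positivity) h2
          rw [Real.log_pow, Real.log_inv] at h3
          have h4 := Real.log_le_sub_one_of_pos (show 0 < |x| / r by positivity)
          push_cast at h3
          linarith
        have hη2 : L / |x| ≤ s := by
          rw [div_le_iff₀ hx]
          refine hL1.trans ?_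
          rw [hs]
          calc 2 * (|x| / r) ≤ E * (|x| / r) := by gcongr; linarith
            _ = _ := by ring
        have hη20 : 0 ≤ L / |x| := by positivity
        have hh16 : h (|x| / 4) ≤ 16 * h |x| := by
          have := H.h_le_sq hρ (l := 4) (by norm_num)
          rw [show 4 * (|x| / 4) = |x| by ring] at this
          linarith
        have hexpL : Real.exp (-L) = t * h |x| := by rw [hL, neg_neg, Real.exp_log hth0]
        have h5 := T2.G_bound ht.le hs0 hQ2 (k := 1) (by norm_num) hη20 hη2 x
        have h6 := Stmt7.expo_le H M hρ hη20 ht.le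
        have h7 : t * (2 * h (|x| / 4) * Real.exp (2 * (L / |x| * (|x| / 4)))) ≤ 32 := by
          have e1 : 2 * (L / |x| * (|x| / 4)) = L / 2 := by field_simp; ring
          rw [e1]
          calc _ ≤ t * (2 * (16 * h |x|) * Real.exp (L / 2)) := by gcongr
            _ = 32 * ((t * h |x|) * Real.exp (L / 2)) := by ring
            _ = 32 * Real.exp (-(L / 2)) := by
                rw [← hexpL, ← Real.exp_add]; congr 2; ring
            _ ≤ 32 * 1 := by
                gcongr
                exact Real.exp_le_one_iff.mpr (by linarith)
            _ = 32 := by norm_num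
        have h8 : Real.exp (-(|x| * (L / |x|)) + t * ((L / |x|) ^ 2 * Real.exp (L / |x| * (|x| / 4)) *
            ∫ y, y ^ 2 * Stmt7.cut μ (|x| / 4) y)) ≤ (t * h |x|) * Real.exp 32 := by
          rw [← hexpL, ← Real.exp_add]
          apply Real.exp_le_exp.mpr
          have e1 : |x| * (L / |x|) = L := by field_simp
          rw [e1]
          linarith
        have h9 := Stmt7.G_diff T2.continuous_phi hφc (N := 2 * h (|x| / 4)) ht.le hs0 hQ2
          (fun ξ => Stmt7.phi_cut_le H M hρ ξ) (fun ξ => Stmt7.phi_cut_diff H M hρ ξ) x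
        calc _ ≤ ‖Stmt7.G φ t 1 x‖ := Complex.abs_re_le_norm _
          _ ≤ _ := h9
          _ ≤ (t * h |x|) * Real.exp 32 * (Q * s ^ (1 + 1) * Real.pi) +
              t * (2 * (16 * h |x|)) * (Q * s ^ 2 * Real.pi) := by
              refine add_le_add (h5.trans ?_) ?_
              · gcongr
              · gcongr
          _ = (t * h |x|) * (Real.exp 32 + 32) * (Q * s ^ 2 * Real.pi) := by ring
          _ ≤ (t * h |x|) * (Real.exp 32 + 32) * (Q * Real.pi * E ^ 3 * (1 / r ^ 2)) := by gcongr
          _ = (Real.exp 32 + 32) * (Q * Real.pi * E ^ 3) * (1 / r ^ 2) * (t * h |x|) := by ring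
          _ ≤ V * (1 / r ^ 2) * (t * h |x|) := by gcongr
end
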